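/- There exists m ≥ 1 with the following property. There is no family of line segments, indexed by the symbols of the Hart–Sharir sequence S₇(m), with all endpoints on the parabola y = x² and with pairwise distinct endpoint x-coordinates, such that both: (i) the endpoints appear from left to right exactly in the order prescribed by the endpoint sequence E(S₇(m)) (i.e., reading the endpoints by increasing x-coordinate yields E(S₇(m)), where the left endpoint of the segment of symbol a corresponds to L_a and its right endpoint to R_a); and (ii) whenever symbols a₁, …, a_j of S₇(m) form an N-shaped subsequence of S₇(m), i.e., S₇(m) contains the subsequence a₁ a₂ ⋯ a_j a_{j−1} ⋯ a₂ a₁ a₂ ⋯ a_j, the corresponding j segments intersect concavely. -/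

import Mathlib

/-! ### Sequences with special blocks, encoded as token lists

A sequence with special blocks is encoded as a list of tokens: `Tok.sym a` is an
occurrence of the symbol `a`, and `Tok.op` / `Tok.cl` are the opening and closing
parentheses delimiting the special blocks. -/

/-- Tokens of a symbol sequence with special blocks. -/
inductive Tok : Type where
  | sym : ℕ → Tok
  | op : Tok
  | cl : Tok
deriving DecidableEq, Repr

/-- Tokens of an endpoint sequence with special blocks: `L a` / `R a` are the
left/right endpoint letters of the symbol `a`, and `op`/`cl` delimit blocks. -/
inductive ETok : Type where
  | L : ℕ → ETok
  | R : ℕ → ETok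
  | op : ETok
  | cl : ETok
deriving DecidableEq, Repr

/-- Fresh relabeling of the symbols of the `i`-th local copy. -/
def loc (i a : ℕ) : ℕ := 2 * Nat.pair i a

/-- Relabeling of the global symbols. -/
def glob (a : ℕ) : ℕ := 2 * a + 1

/-- The underlying sequence of symbols of a token list (parentheses dropped). -/
def symsOf : List Tok → List ℕ
  | [] => []
  | Tok.sym a :: r => a :: symsOf r
  | _ :: r => symsOf r

/-- Read a special block: the symbols up to (and excluding) the next closing
parenthesis, together with the remainder of the list after that parenthesis. -/
def takeBlock : List Tok → List ℕ × List Tok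
  | [] => ([], [])
  | Tok.cl :: r => ([], r)
  | Tok.sym a :: r => ((takeBlock r).1.cons a, (takeBlock r).2)
  | Tok.op :: r => takeBlock r

theorem takeBlock_len : ∀ l : List Tok, (takeBlock l).2.length ≤ l.length := by
  intro l
  induction l with
  | nil => simp [takeBlock]
  | cons t r ih => cases t <;> simp [takeBlock] <;> omega

/-- Auxiliary function for the shuffle `A • B`: traverse the `i`-th fresh copy of
`A` (relabeling its symbols by `loc i`), inserting the next global symbol of the
list `ins` (relabeled by `glob`) at the end of each special block and duplicating
the previously last symbol of that block immediately after the block.  The third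
argument remembers the (relabeled) last symbol seen. -/
def copyIns (i : ℕ) : List Tok → List ℕ → Option ℕ → List Tok
  | [], _, _ => []
  | Tok.sym a :: r, ins, _ => Tok.sym (loc i a) :: copyIns i r ins (some (loc i a))
  | Tok.op :: r, ins, p => Tok.op :: copyIns i r ins p
  | Tok.cl :: r, b :: ins, some q =>
      Tok.sym (glob b) :: Tok.cl :: Tok.sym q :: copyIns i r ins (some q)
  | Tok.cl :: r, ins, p => Tok.cl :: copyIns i r ins p

/-- The modified copy `Aᵢ'` of `A` used in the shuffle `A • B`: the symbols of the
`i`-th special block `blk` of `B` are inserted into the special blocks of the copy,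
and another copy of the last symbol of `blk` is appended at the very end. -/
def copyA (i : ℕ) (A : List Tok) (blk : List ℕ) : List Tok :=
  copyIns i A blk none ++ (blk.getLast?.elim [] fun a => [Tok.sym (glob a)])

/-- Auxiliary function for the shuffle: traverse `B` (relabeling its symbols by
`glob`), replacing its `i`-th special block by the modified `i`-th copy of `A`. -/
def bulletAux (A : List Tok) : ℕ → List Tok → List Tok
  | _, [] => []
  | i, Tok.op :: r => copyA i A (takeBlock r).1 ++ bulletAux A (i + 1) (takeBlock r).2
  | i, Tok.sym a :: r => Tok.sym (glob a) :: bulletAux A i r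
  | i, Tok.cl :: r => Tok.cl :: bulletAux A i r
termination_by _ l => l.length
decreasing_by
  · exact Nat.lt_succ_of_le (takeBlock_len r)
  · exact Nat.lt_succ_self _
  · exact Nat.lt_succ_self _

/-- The shuffle `A • B` of two sequences with special blocks. -/
def bullet (A B : List Tok) : List Tok := bulletAux A 0 B

/-- Split each special block of length 2 into two special blocks of length 1. -/
def split2 : List Tok → List Tok
  | Tok.op :: Tok.sym a :: Tok.sym b :: Tok.cl :: r =>
      Tok.op :: Tok.sym a :: Tok.cl :: Tok.op :: Tok.sym b :: Tok.cl :: split2 r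
  | t :: r => t :: split2 r
  | [] => []

/-- The Hart–Sharir sequence `S₁(m) = (1 2 ⋯ m) (m−1) ⋯ 2 1 2 ⋯ m`,
with a single special block `(1 2 ⋯ m)`. -/
def S1 (m : ℕ) : List Tok :=
  Tok.op :: ((List.range' 1 m).map Tok.sym) ++ Tok.cl ::
    (((List.range' 1 (m - 1)).reverse.map Tok.sym) ++ ((List.range' 2 (m - 1)).map Tok.sym))

/-- The number of special blocks of a token sequence. -/
def numBlocks (S : List Tok) : ℕ := S.count Tok.op

/-- The Hart–Sharir sequences `S_k(m)`, defined by double recursion: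
`S₁(m)` is the `N`-shaped sequence above; for `k ≥ 2`, `S_k(1)` is `S_{k−1}(2)` with
each special block of length 2 split into two special blocks of length 1; and for
`k, m ≥ 2`, `S_k(m) = S_k(m−1) • S_{k−1}(N)` where `N` is the number of special
blocks of `S_k(m−1)`.  (The value for `k = 0` or `m = 0` is junk.) -/
def HS : ℕ → ℕ → List Tok
  | 0, _ => []
  | 1, m => S1 m
  | _ + 2, 0 => []
  | k + 2, 1 => split2 (HS (k + 1) 2)
  | k + 2, m + 2 => bullet (HS (k + 2) (m + 1)) (HS (k + 1) (numBlocks (HS (k + 2) (m + 1))))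
termination_by k m => (k, m)



/-- The list of special blocks of a token sequence (each block as its list of symbols). -/
def blocksOf : List Tok → List (List ℕ)
  | [] => []
  | Tok.op :: r => (takeBlock r).1 :: blocksOf (takeBlock r).2
  | _ :: r => blocksOf r
termination_by l => l.length
decreasing_by
  · exact Nat.lt_succ_of_le (takeBlock_len r)
  · exact Nat.lt_succ_self _

/-- The rank of a symbol: the position (counting from 1) that its first occurrence
occupies within its special block (`0` if the symbol lies in no special block). -/
def rankOf (S : List Tok) (a : ℕ) : ℕ :=
  match (blocksOf S).find? (fun b => decide (a ∈ b)) with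
  | some b => b.idxOf a + 1
  | none => 0

/-- Two symbols have their first occurrences in the same special block. -/
def SameBlock (S : List Tok) (a b : ℕ) : Prop :=
  ∃ blk ∈ blocksOf S, a ∈ blk ∧ b ∈ blk

/-- The symbol `a` is left-clamped in the sequence `s`: `s` contains the
subsequence `b a b a`, where `b` is the symbol immediately preceding the first
occurrence of `a` in `s`. -/
def LeftClamped (s : List ℕ) (a : ℕ) : Prop :=
  ∃ (u v : List ℕ) (b : ℕ), s = u ++ b :: a :: v ∧ a ∉ u ∧ b ≠ a ∧
    [b, a, b, a].Sublist s

/-- The symbol `a` is right-clamped in the sequence `s`: `s` contains the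
subsequence `a b a b`, where `b` is the symbol immediately following the last
occurrence of `a` in `s`. -/
def RightClamped (s : List ℕ) (a : ℕ) : Prop :=
  ∃ (u v : List ℕ) (b : ℕ), s = u ++ a :: b :: v ∧ a ∉ v ∧ b ≠ a ∧
    [a, b, a, b].Sublist s

/-- Auxiliary function for the endpoint sequence: the first argument collects the
symbols already seen.  The first occurrence of each symbol becomes an `L` letter,
its last occurrence becomes an `R` letter, all other occurrences are deleted, and
parentheses are kept. -/
def EAux : List ℕ → List Tok → List ETok
  | _, [] => []
  | seen, Tok.op :: r => ETok.op :: EAux seen r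
  | seen, Tok.cl :: r => ETok.cl :: EAux seen r
  | seen, Tok.sym a :: r =>
      if a ∈ seen then
        if a ∈ symsOf r then EAux seen r else ETok.R a :: EAux seen r
      else ETok.L a :: EAux (a :: seen) r

/-- The endpoint sequence `E(S)` of a sequence with special blocks. -/
def Efun (S : List Tok) : List ETok := EAux [] S

/-- Read a special block of an endpoint sequence: the labels of the `L` letters up
to the next closing parenthesis, and the remainder of the list after it. -/
def takeBlockE : List ETok → List ℕ × List ETok
  | [] => ([], [])
  | ETok.cl :: r => ([], r)
  | ETok.L a :: r => ((takeBlockE r).1.cons a, (takeBlockE r).2)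
  | _ :: r => takeBlockE r

theorem takeBlockE_len : ∀ l : List ETok, (takeBlockE l).2.length ≤ l.length := by
  intro l
  induction l with
  | nil => simp [takeBlockE]
  | cons t r ih => cases t <;> simp [takeBlockE] <;> omega

/-- Auxiliary function for the endpoint shuffle `A ∘ B`: traverse the `i`-th fresh
copy of `A` (relabeling by `loc i`), inserting the next left-endpoint letter of the
list `ins` (relabeled by `glob`) at the end of each special block. -/
def ecopyIns (i : ℕ) : List ETok → List ℕ → List ETok
  | [], _ => []
  | ETok.L a :: r, ins => ETok.L (loc i a) :: ecopyIns i r ins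
  | ETok.R a :: r, ins => ETok.R (loc i a) :: ecopyIns i r ins
  | ETok.op :: r, ins => ETok.op :: ecopyIns i r ins
  | ETok.cl :: r, b :: ins => ETok.L (glob b) :: ETok.cl :: ecopyIns i r ins
  | ETok.cl :: r, [] => ETok.cl :: ecopyIns i r []

/-- Auxiliary function for the endpoint shuffle: traverse `B` (relabeling by
`glob`), replacing its `i`-th special block by the `i`-th modified copy of `A`. -/
def eshufAux (A : List ETok) : ℕ → List ETok → List ETok
  | _, [] => []
  | i, ETok.op :: r => ecopyIns i A (takeBlockE r).1 ++ eshufAux A (i + 1) (takeBlockE r).2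
  | i, ETok.L a :: r => ETok.L (glob a) :: eshufAux A i r
  | i, ETok.R a :: r => ETok.R (glob a) :: eshufAux A i r
  | i, ETok.cl :: r => ETok.cl :: eshufAux A i r
termination_by _ l => l.length
decreasing_by
  · exact Nat.lt_succ_of_le (takeBlockE_len r)
  · exact Nat.lt_succ_self _
  · exact Nat.lt_succ_self _
  · exact Nat.lt_succ_self _

/-- The endpoint shuffle `A ∘ B` of two endpoint sequences with special blocks. -/
def eshuffle (A B : List ETok) : List ETok := eshufAux A 0 B

/-- The token list is a well-formed sequence with special blocks: a concatenation
of symbols and of parenthesized blocks consisting only of symbols. -/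
inductive Blocked : List Tok → Prop
  | nil : Blocked []
  | sym (a : ℕ) {l : List Tok} : Blocked l → Blocked (Tok.sym a :: l)
  | blk (b : List ℕ) {l : List Tok} :
      Blocked l → Blocked (Tok.op :: b.map Tok.sym ++ Tok.cl :: l)

/-- The special blocks of `S` contain only first occurrences of symbols, and every
symbol of `S` makes its first occurrence inside a special block. -/
def FirstOccBlocks (S : List Tok) : Prop :=
  (∀ (u b v : List Tok), S = u ++ Tok.op :: b ++ Tok.cl :: v →
      ∀ a : ℕ, Tok.sym a ∈ b → a ∉ symsOf u ∧ (symsOf b).count a = 1) ∧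
  (∀ a ∈ symsOf S, ∃ (u b v : List Tok),
      S = u ++ Tok.op :: b ++ Tok.cl :: v ∧ Tok.sym a ∈ b ∧ a ∉ symsOf u)

/-! ### Geometry of the parabola -/

/-- The point of the parabola `y = x²` with x-coordinate `t`. -/
noncomputable def Ppt (t : ℝ) : ℝ × ℝ := (t, t ^ 2)

/-- The closed straight-line segment between the points of the parabola with
x-coordinates `a` and `b`. -/
noncomputable def Seg (a b : ℝ) : Set (ℝ × ℝ) := segment ℝ (Ppt a) (Ppt b)

/-- Given left and right endpoint x-coordinates `xL`, `xR` for the segments named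
by labels, the segments named by the list `ls = [s₁, …, sₘ]` intersect concavely:
for each three consecutive members, the intersection point `s_{k+2} ∩ s_{k+1}` lies
strictly to the left of the intersection point `s_{k+1} ∩ s_k`; that is, the
intersection points `sₘ ∩ sₘ₋₁, …, s₂ ∩ s₁` have strictly increasing x-coordinates. -/
def ConcaveChain (xL xR : ℕ → ℝ) (ls : List ℕ) : Prop :=
  ∀ k, k + 3 ≤ ls.length → ∀ z w : ℝ × ℝ,
    z ∈ Seg (xL (ls.getD (k + 2) 0)) (xR (ls.getD (k + 2) 0)) ∩
        Seg (xL (ls.getD (k + 1) 0)) (xR (ls.getD (k + 1) 0)) →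
    w ∈ Seg (xL (ls.getD (k + 1) 0)) (xR (ls.getD (k + 1) 0)) ∩
        Seg (xL (ls.getD k 0)) (xR (ls.getD k 0)) →
    z.1 < w.1

/-- The list of endpoint x-coordinates read along an endpoint sequence. -/
noncomputable def coordList (xL xR : ℕ → ℝ) (S : List ETok) : List ℝ :=
  S.filterMap fun t =>
    match t with
    | ETok.L a => some (xL a)
    | ETok.R a => some (xR a)
    | _ => none

/-- The family of segments with endpoints on the parabola given by the endpoint
x-coordinates `xL`, `xR` realizes the endpoint sequence `S`: reading the endpoints
by increasing x-coordinate yields exactly `S` (in particular all endpoint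
x-coordinates are pairwise distinct). -/
noncomputable def Realizes (xL xR : ℕ → ℝ) (S : List ETok) : Prop :=
  (coordList xL xR S).Chain' (· < ·)

/-! ### Marked sequences -/

/-- Tokens of a marked sequence: `mid a` and `last a` are a middle and the last
occurrence of the symbol `a`, and `blk bs` is a special block `bs` followed by the
repetition of all symbols of `bs` but the last one, in reverse order. -/
inductive RTok : Type where
  | mid : ℕ → RTok
  | last : ℕ → RTok
  | blk : List ℕ → RTok

namespace RTok

/-- The sequence with special blocks described by one marked token. -/
def toTok : RTok → List Tok
  | mid a => [Tok.sym a]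
  | last a => [Tok.sym a]
  | blk bs => Tok.op :: (bs.map Tok.sym ++ Tok.cl :: bs.dropLast.reverse.map Tok.sym)

/-- The number of special blocks of one marked token. -/
def nb : RTok → ℕ
  | blk _ => 1
  | _ => 0

end RTok

/-- The sequence with special blocks described by a marked sequence. -/
def toToks (S : List RTok) : List Tok := S.flatMap RTok.toTok

/-- The number of special blocks of a marked sequence. -/
def nbs (S : List RTok) : ℕ := (S.map RTok.nb).sum

/-- The `i`-th copy of `S`, with the symbols of `cs` appended to its special blocks. -/
def copyR (i : ℕ) : List RTok → List ℕ → List RTok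
  | [], _ => []
  | RTok.mid a :: r, cs => RTok.mid (loc i a) :: copyR i r cs
  | RTok.last a :: r, cs => RTok.last (loc i a) :: copyR i r cs
  | RTok.blk bs :: r, cs =>
      RTok.blk (bs.map (loc i) ++ cs.head?.toList.map glob) :: copyR i r cs.tail

/-- The shuffle of marked sequences. -/
def bulletR (A : List RTok) : ℕ → List RTok → List RTok
  | _, [] => []
  | i, RTok.mid a :: r => RTok.mid (glob a) :: bulletR A i r
  | i, RTok.last a :: r => RTok.last (glob a) :: bulletR A i r
  | i, RTok.blk bs :: r =>
      copyR i A bs ++ (bs.reverse.map fun b => RTok.mid (glob b)) ++ bulletR A (i + 1) r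

/-- Splitting the special blocks of a marked sequence into blocks of length one. -/
def splitR : List RTok → List RTok
  | [] => []
  | RTok.blk bs :: r =>
      (bs.map fun b => RTok.blk [b]) ++ (bs.dropLast.reverse.map RTok.mid) ++ splitR r
  | t :: r => t :: splitR r

/-- The marked Hart–Sharir sequences; `HSR k m` describes `HS (k + 2) (m + 1)`. -/
def HSR : ℕ → ℕ → List RTok
  | 0, 0 => [RTok.blk [1], RTok.blk [2], RTok.last 1, RTok.last 2]
  | 0, m + 1 => copyR 0 (HSR 0 m) [1, 2] ++
      [RTok.mid (glob 2), RTok.last (glob 1), RTok.last (glob 2)]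
  | k + 1, 0 => splitR (HSR k 1)
  | k + 1, m + 1 => bulletR (HSR (k + 1) m) 0 (HSR k (nbs (HSR (k + 1) m) - 1))
termination_by k m => (k, m)

/-- All special blocks of `S` have length `n`. -/
def BlockLen (n : ℕ) (S : List RTok) : Prop := ∀ bs, RTok.blk bs ∈ S → bs.length = n

@[simp] theorem toToks_nil : toToks [] = [] := rfl
@[simp] theorem toToks_cons (t : RTok) (S : List RTok) :
    toToks (t :: S) = t.toTok ++ toToks S := rfl
@[simp] theorem toToks_append (S T : List RTok) : toToks (S ++ T) = toToks S ++ toToks T := by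
  simp [toToks]
@[simp] theorem nbs_nil : nbs [] = 0 := rfl
@[simp] theorem nbs_cons (t : RTok) (S : List RTok) : nbs (t :: S) = t.nb + nbs S := rfl
@[simp] theorem nbs_append (S T : List RTok) : nbs (S ++ T) = nbs S + nbs T := by
  simp [nbs]

theorem toToks_map_mid (f : ℕ → ℕ) (l : List ℕ) :
    toToks (l.map fun b => RTok.mid (f b)) = l.map fun b => Tok.sym (f b) := by
  induction l with
  | nil => rfl
  | cons b l ih => simp [ih, RTok.toTok]

theorem BlockLen.tail {n : ℕ} {t : RTok} {S : List RTok} (h : BlockLen n (t :: S)) :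
    BlockLen n S := fun bs hbs => h bs (List.mem_cons_of_mem _ hbs)

theorem numBlocks_toToks (S : List RTok) : numBlocks (toToks S) = nbs S := by
  have aux : ∀ l : List ℕ, (l.map Tok.sym).count Tok.op = 0 := by
    intro l
    rw [List.count_eq_zero]
    simp
  induction S with
  | nil => rfl
  | cons t S ih =>
    simp only [numBlocks] at ih ⊢
    cases t with
    | blk bs =>
      simp only [toToks_cons, RTok.toTok, List.count_append, List.count_cons, aux, ih, nbs_cons,
        RTok.nb]
      simp
    | _ => simp [RTok.toTok, RTok.nb, ih]

theorem takeBlock_block (bs : List ℕ) (r : List Tok) :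
    takeBlock (bs.map Tok.sym ++ Tok.cl :: r) = (bs, r) := by
  induction bs with
  | nil => simp [takeBlock]
  | cons b bs ih => simp [takeBlock, ih]

theorem copyIns_syms (i : ℕ) (bs : List ℕ) (r : List Tok) (cs : List ℕ) (p : Option ℕ) :
    copyIns i (bs.map Tok.sym ++ r) cs p =
      bs.map (fun b => Tok.sym (loc i b)) ++
        copyIns i r cs ((bs.getLast?.map (loc i)).or p) := by
  induction bs generalizing p with
  | nil => simp
  | cons b bs ih =>
    simp only [List.map_cons, List.cons_append, copyIns, ih, List.getLast?_cons]
    cases bs.getLast? <;> simp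

theorem copyIns_toToks (i n : ℕ) (A : List RTok) (hA : BlockLen (n + 1) A) (cs : List ℕ)
    (hcs : cs.length = nbs A) (p : Option ℕ) :
    copyIns i (toToks A) cs p = toToks (copyR i A cs) := by
  induction A generalizing cs p with
  | nil => simp [copyR, copyIns]
  | cons t A ih =>
    cases t with
    | mid a => simp [copyR, copyIns, RTok.toTok, ih hA.tail cs (by simpa [RTok.nb] using hcs)]
    | last a => simp [copyR, copyIns, RTok.toTok, ih hA.tail cs (by simpa [RTok.nb] using hcs)]
    | blk bs =>
      have hlen := hA bs (by simp)
      obtain ⟨bs', q, rfl⟩ := (List.eq_nil_or_concat' bs).resolve_left (by rintro rfl; simp at hlen)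
      cases cs with
      | nil => simp [RTok.nb] at hcs; omega
      | cons c cs =>
        have ih' := fun p => ih hA.tail cs (by simp [RTok.nb] at hcs; omega) p
        simp only [toToks_cons, RTok.toTok, copyR, List.cons_append, List.append_assoc, copyIns,
          copyIns_syms]
        have h : ((bs' ++ [q]).getLast?.map (loc i)).or p = some (loc i q) := by simp
        simp only [h, copyIns, copyIns_syms, ih']
        simp [Function.comp_def]

theorem bulletAux_syms (A : List Tok) (i : ℕ) (bs : List ℕ) (r : List Tok) :
    bulletAux A i (bs.map Tok.sym ++ r) =
      bs.map (fun b => Tok.sym (glob b)) ++ bulletAux A i r := by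
  induction bs with
  | nil => simp
  | cons b bs ih => simp [bulletAux, ih]

theorem bulletAux_toToks (n : ℕ) (A : List RTok) (hA : BlockLen (n + 1) A) (hn : 0 < nbs A)
    (S : List RTok) (hS : BlockLen (nbs A) S) (i : ℕ) :
    bulletAux (toToks A) i (toToks S) = toToks (bulletR A i S) := by
  induction S generalizing i with
  | nil => simp [bulletR, bulletAux]
  | cons t S ih =>
    cases t with
    | mid a => simp [bulletR, bulletAux, RTok.toTok, ih hS.tail]
    | last a => simp [bulletR, bulletAux, RTok.toTok, ih hS.tail]
    | blk bs =>
      have hlen := hS bs (by simp)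
      have hbs : bs ≠ [] := by rintro rfl; simp at hlen; omega
      obtain ⟨bs', q, rfl⟩ := (List.eq_nil_or_concat' bs).resolve_left hbs
      simp only [toToks_cons, RTok.toTok, List.cons_append, List.append_assoc, bulletAux,
        takeBlock_block, copyA, copyIns_toToks i n A hA _ hlen, bulletR, toToks_append,
        toToks_map_mid, bulletAux_syms, ih hS.tail]
      simp

@[simp] theorem nbs_map_mid {α : Type*} (f : α → ℕ) (l : List α) :
    nbs (l.map fun b => RTok.mid (f b)) = 0 := by
  induction l with
  | nil => rfl
  | cons b l ih => simp [ih, RTok.nb]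

@[simp] theorem nbs_copyR (i : ℕ) (A : List RTok) (cs : List ℕ) :
    nbs (copyR i A cs) = nbs A := by
  induction A generalizing cs with
  | nil => rfl
  | cons t A ih => cases t <;> simp [copyR, ih, RTok.nb]

theorem nbs_bulletR (A : List RTok) (i : ℕ) (S : List RTok) :
    nbs (bulletR A i S) = nbs S * nbs A := by
  induction S generalizing i with
  | nil => simp [bulletR]
  | cons t S ih => cases t <;> simp [bulletR, ih, RTok.nb, Nat.add_mul, -List.map_reverse]

theorem nbs_map_blk (l : List ℕ) : nbs (l.map fun b => RTok.blk [b]) = l.length := by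
  induction l with
  | nil => rfl
  | cons b l ih => simp [ih, RTok.nb, Nat.add_comm]

theorem nbs_splitR {n : ℕ} {S : List RTok} (hS : BlockLen n S) :
    nbs (splitR S) = n * nbs S := by
  induction S with
  | nil => rfl
  | cons t S ih =>
    cases t with
    | blk bs =>
      have h := nbs_map_mid id bs.dropLast.reverse
      simp only [id] at h
      simp only [splitR, nbs_append, nbs_map_blk, h, ih hS.tail, hS bs (by simp), nbs_cons,
        RTok.nb]
      ring
    | _ => simp [splitR, RTok.nb, ih hS.tail]

theorem BlockLen.append {n : ℕ} {S T : List RTok} (hS : BlockLen n S) (hT : BlockLen n T) :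
    BlockLen n (S ++ T) := fun bs hbs => (List.mem_append.1 hbs).elim (hS bs) (hT bs)

theorem BlockLen.copyR {n : ℕ} (i : ℕ) {A : List RTok} (hA : BlockLen n A) {cs : List ℕ}
    (hcs : nbs A ≤ cs.length) : BlockLen (n + 1) (copyR i A cs) := by
  induction A generalizing cs with
  | nil => simp [_root_.copyR, BlockLen]
  | cons t A ih =>
    cases t with
    | blk bs =>
      cases cs with
      | nil => simp [RTok.nb] at hcs
      | cons c cs =>
        intro bs' h
        rcases List.mem_cons.1 h with h | h
        · rw [RTok.blk.inj h]
          simp [hA bs (by simp)]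
        · exact ih hA.tail (cs := cs) (by simp [RTok.nb] at hcs; omega) bs' h
    | _ =>
      intro bs' h
      refine ih hA.tail (cs := cs) (by simpa [RTok.nb] using hcs) bs' ?_
      simpa [_root_.copyR] using h

theorem BlockLen.bulletR {n : ℕ} {A S : List RTok} (hA : BlockLen n A)
    (hS : BlockLen (nbs A) S) (i : ℕ) : BlockLen (n + 1) (bulletR A i S) := by
  induction S generalizing i with
  | nil => simp [_root_.bulletR, BlockLen]
  | cons t S ih =>
    cases t with
    | blk bs =>
      refine BlockLen.append (BlockLen.append (hA.copyR i (hS bs (by simp)).ge) ?_) (ih hS.tail _)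
      intro bs' h
      simp at h
    | _ =>
      intro bs' h
      refine ih hS.tail i bs' ?_
      simpa [_root_.bulletR] using h

theorem blockLen_splitR (S : List RTok) : BlockLen 1 (splitR S) := by
  induction S with
  | nil => simp [splitR, BlockLen]
  | cons t S ih =>
    cases t with
    | blk bs =>
      refine BlockLen.append (BlockLen.append ?_ ?_) ih
      · intro bs' h
        simp only [List.mem_map] at h
        obtain ⟨b, -, h⟩ := h
        rw [← RTok.blk.inj h]
        rfl
      · intro bs' h
        simp only [List.mem_map] at h
        obtain ⟨b, -, h⟩ := h
        cases h
    | _ =>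
      intro bs' h
      exact ih bs' (by simpa [splitR] using h)

theorem HSR_spec (k m : ℕ) : BlockLen (m + 1) (HSR k m) ∧ 2 ≤ nbs (HSR k m) := by
  induction k generalizing m with
  | zero =>
    suffices BlockLen (m + 1) (HSR 0 m) ∧ nbs (HSR 0 m) = 2 from ⟨this.1, this.2.ge⟩
    induction m with
    | zero => simp [HSR, BlockLen, RTok.nb]
    | succ m ih =>
      rw [HSR]
      refine ⟨BlockLen.append (ih.1.copyR 0 (by simp [ih.2])) (by simp [BlockLen]), ?_⟩
      simp [ih.2, RTok.nb]
  | succ k ihk =>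
    induction m with
    | zero =>
      rw [HSR]
      refine ⟨blockLen_splitR _, ?_⟩
      rw [nbs_splitR (ihk 1).1]
      have := (ihk 1).2
      omega
    | succ m ih =>
      rw [HSR]
      have h := ihk (nbs (HSR (k + 1) m) - 1)
      rw [Nat.sub_add_cancel (by omega)] at h
      refine ⟨ih.1.bulletR h.1 0, ?_⟩
      rw [nbs_bulletR]
      nlinarith [h.2, ih.2]

theorem blockLen_HSR (k m : ℕ) : BlockLen (m + 1) (HSR k m) := (HSR_spec k m).1

theorem two_le_nbs_HSR (k m : ℕ) : 2 ≤ nbs (HSR k m) := (HSR_spec k m).2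

theorem nbs_HSR_zero (m : ℕ) : nbs (HSR 0 m) = 2 := by
  induction m with
  | zero => simp [HSR, RTok.nb]
  | succ m ih => simp [HSR, ih, RTok.nb]

theorem lt_nbs_HSR (k m : ℕ) : m + 1 < nbs (HSR (k + 1) m) := by
  induction m with
  | zero => exact two_le_nbs_HSR _ _
  | succ m ih =>
    rw [HSR, nbs_bulletR]
    nlinarith [two_le_nbs_HSR k (nbs (HSR (k + 1) m) - 1)]

theorem split2_toToks (S : List RTok) (hS : BlockLen 2 S) :
    split2 (toToks S) = toToks (splitR S) := by
  induction S with
  | nil => simp [splitR, split2]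
  | cons t S ih =>
    cases t with
    | blk bs =>
      have h := hS bs (by simp)
      obtain ⟨a, b, rfl⟩ := List.length_eq_two.1 h
      simp [splitR, split2, RTok.toTok, ih hS.tail]
    | _ => simp [splitR, split2, RTok.toTok, ih hS.tail]

theorem S1_two : S1 2 = [Tok.op, Tok.sym 1, Tok.sym 2, Tok.cl, Tok.sym 1, Tok.sym 2] := rfl

theorem HS_eq_toToks (k m : ℕ) : HS (k + 2) (m + 1) = toToks (HSR k m) := by
  induction k generalizing m with
  | zero =>
    induction m with
    | zero => simp [HS, HSR, S1_two, split2, RTok.toTok]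
    | succ m ih =>
      rw [HS, ih, numBlocks_toToks, nbs_HSR_zero, HS, S1_two, HSR]
      simp [bullet, bulletAux, takeBlock, copyA, RTok.toTok,
        copyIns_toToks 0 m _ (blockLen_HSR 0 m) [1, 2] (by simp [nbs_HSR_zero])]
  | succ k ihk =>
    induction m with
    | zero => rw [HS, ihk 1, HSR, split2_toToks _ (blockLen_HSR k 1)]
    | succ m ih =>
      have h2 := two_le_nbs_HSR (k + 1) m
      have h := ihk (nbs (HSR (k + 1) m) - 1)
      have hb := blockLen_HSR k (nbs (HSR (k + 1) m) - 1)
      rw [Nat.sub_add_cancel (by omega)] at h hb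
      rw [HS, ih, numBlocks_toToks, h, HSR, bullet,
        bulletAux_toToks m _ (blockLen_HSR (k + 1) m) (by omega) _ hb]

/-! ### Occurrences in marked sequences -/

/-- The effect of a marked token on the state of the symbol `a`, which is `0` before
the first, `1` between the first and the last, and `2` after the last occurrence. -/
def occStep (a : ℕ) : RTok → ℕ → Option ℕ
  | RTok.mid b, s => if b = a then (if s = 1 then some 1 else none) else some s
  | RTok.last b, s => if b = a then (if s = 1 then some 2 else none) else some s
  | RTok.blk bs, s =>
      if a ∈ bs then (if s = 0 ∧ bs.count a = 1 then some 1 else none) else some s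

/-- The effect of a marked sequence on the state of the symbol `a`. -/
def occRun (a : ℕ) : List RTok → ℕ → Option ℕ
  | [], s => some s
  | t :: S, s => (occStep a t s).bind (occRun a S)

/-- Every symbol that occurs is correctly marked. -/
def WellMarked (S : List RTok) : Prop :=
  ∀ a, occRun a S 0 = some 0 ∨ occRun a S 0 = some 2

theorem occRun_append (a : ℕ) (S T : List RTok) (s : ℕ) :
    occRun a (S ++ T) s = (occRun a S s).bind (occRun a T) := by
  induction S generalizing s with
  | nil => simp [occRun]
  | cons t S ih => cases h : occStep a t s <;> simp [occRun, h, ih]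

theorem loc_injective (i : ℕ) : Function.Injective (loc i) := by
  intro a b h
  simpa [loc] using h

theorem loc_inj {i j a b : ℕ} : loc i a = loc j b ↔ i = j ∧ a = b := by
  simp [loc]

theorem glob_injective : Function.Injective glob := by
  intro a b h
  simpa [glob] using h

theorem glob_inj {a b : ℕ} : glob a = glob b ↔ a = b := glob_injective.eq_iff

theorem loc_ne_glob (i a b : ℕ) : loc i a ≠ glob b := by
  simp only [loc, glob]
  omega

theorem exists_loc_or_glob (n : ℕ) : (∃ i a, n = loc i a) ∨ ∃ b, n = glob b := by
  rcases Nat.even_or_odd' n with ⟨c, h | h⟩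
  · exact Or.inl ⟨c.unpair.1, c.unpair.2, by simp [loc, h]⟩
  · exact Or.inr ⟨c, by simp [glob, h]⟩

theorem occRun_loc_copyR (i a : ℕ) (A : List RTok) (cs : List ℕ) (s : ℕ) :
    occRun (loc i a) (copyR i A cs) s = occRun a A s := by
  induction A generalizing cs s with
  | nil => rfl
  | cons t A ih =>
    have hcs : (cs.head?.toList.map glob).count (loc i a) = 0 := by
      rw [List.count_eq_zero]
      simp only [List.mem_map, not_exists, not_and]
      exact fun b _ h => loc_ne_glob i a b h.symm
    cases t with
    | blk bs =>
      have h : occStep (loc i a) (RTok.blk (bs.map (loc i) ++ cs.head?.toList.map glob)) s =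
          occStep a (RTok.blk bs) s := by
        simp only [occStep, List.count_append, hcs, ← List.count_pos_iff (a := loc i a),
          List.count_map_of_injective _ _ (loc_injective i), add_zero, List.count_pos_iff]
      simp [copyR, occRun, h, ih]
    | _ => simp [copyR, occRun, occStep, loc_inj, ih]

theorem occRun_loc_copyR_of_ne {i j : ℕ} (hij : i ≠ j) (a : ℕ) (A : List RTok) (cs : List ℕ)
    (s : ℕ) : occRun (loc i a) (copyR j A cs) s = some s := by
  induction A generalizing cs with
  | nil => rfl
  | cons t A ih =>
    cases t with
    | blk bs =>
      have h : loc i a ∉ bs.map (loc j) ++ cs.head?.toList.map glob := by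
        simp only [List.mem_append, List.mem_map, not_or, not_exists, not_and, loc_inj]
        exact ⟨fun b _ h => absurd h.symm hij, fun b _ h => loc_ne_glob i a b h.symm⟩
      simp [copyR, occRun, occStep, h, ih]
    | _ => simp [copyR, occRun, occStep, loc_inj, hij.symm, ih]

theorem occRun_glob_copyR (i b : ℕ) (A : List RTok) (cs : List ℕ) (hcs : cs.length ≤ nbs A)
    (s t : ℕ) (h : occStep b (RTok.blk cs) s = some t) :
    occRun (glob b) (copyR i A cs) s = some t := by
  induction A generalizing cs s with
  | nil =>
    obtain rfl : cs = [] := by simpa using hcs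
    simpa [occStep, copyR, occRun] using h
  | cons u A ih =>
    cases u with
    | blk bs =>
      have hb : ∀ l : List ℕ, glob b ∉ l.map (loc i) := by
        intro l h
        obtain ⟨x, -, hx⟩ := List.mem_map.1 h
        exact loc_ne_glob i x b hx
      cases cs with
      | nil =>
        have := ih [] (by simp) s h
        simp [copyR, occRun, occStep, loc_ne_glob, this]
      | cons c cs =>
        have hlen : cs.length ≤ nbs A := by simp [RTok.nb] at hcs; omega
        by_cases hc : c = b
        · subst hc
          simp only [occStep, List.mem_cons_self, if_true, List.count_cons_self] at h
          split_ifs at h with h'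
          have hc0 : cs.count c = 0 := by omega
          have hmem : c ∉ cs := List.count_eq_zero.1 hc0
          have := ih cs hlen 1 (by simpa [occStep, hmem] using h)
          simp [copyR, occRun, occStep, loc_ne_glob, this, List.count_append, h'.1,
            List.count_eq_zero.2 (hb bs)]
        · have := ih cs hlen s (by
            simpa [occStep, List.count_cons_of_ne hc, Ne.symm hc] using h)
          simp [copyR, occRun, occStep, loc_ne_glob, this, glob_inj, Ne.symm hc]
    | _ =>
      have := ih cs (by simpa [RTok.nb] using hcs) s h
      simp [copyR, occRun, occStep, loc_ne_glob, this]

theorem occRun_map_mid (a : ℕ) (f : ℕ → ℕ) (l : List ℕ) (s : ℕ)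
    (h : ∀ b ∈ l, f b = a → s = 1) : occRun a (l.map fun b => RTok.mid (f b)) s = some s := by
  induction l with
  | nil => rfl
  | cons b l ih =>
    have ih := ih fun c hc => h c (List.mem_cons_of_mem _ hc)
    have hb := h b (by simp)
    simp only [List.map_cons, occRun, occStep]
    split_ifs with h1 h2
    · subst h2; simpa using ih
    · exact absurd (hb h1) h2
    · simpa using ih

theorem occRun_glob_bulletR (A : List RTok) (b : ℕ) (S : List RTok) (hS : BlockLen (nbs A) S)
    (i s t : ℕ) (h : occRun b S s = some t) : occRun (glob b) (bulletR A i S) s = some t := by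
  induction S generalizing i s with
  | nil => exact h
  | cons u S ih =>
    simp only [occRun, Option.bind_eq_some_iff] at h
    obtain ⟨s', h1, h2⟩ := h
    have ih := fun i => ih hS.tail i s' h2
    cases u with
    | blk bs =>
      have hm : occRun (glob b) (bs.reverse.map fun b => RTok.mid (glob b)) s' = some s' := by
        refine occRun_map_mid _ _ _ _ fun c hc hcb => ?_
        obtain rfl := glob_inj.1 hcb
        simp only [occStep, List.mem_reverse.1 hc, if_true] at h1
        split_ifs at h1
        simpa using h1.symm
      simp only [bulletR, occRun_append, occRun_glob_copyR i b A bs (hS bs (by simp)).le s s' h1,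
        Option.bind_some, hm, ih]
    | _ => simp_all [bulletR, occRun, occStep, glob_inj]

theorem occRun_loc_bulletR_of_lt (A : List RTok) {i j : ℕ} (hij : i < j) (a : ℕ) (S : List RTok)
    (s : ℕ) : occRun (loc i a) (bulletR A j S) s = some s := by
  induction S generalizing j with
  | nil => rfl
  | cons u S ih =>
    cases u with
    | blk bs =>
      have hm : occRun (loc i a) (bs.reverse.map fun b => RTok.mid (glob b)) s = some s :=
        occRun_map_mid _ _ _ _ fun c _ h => absurd h.symm (loc_ne_glob i a c)
      simp only [bulletR, occRun_append, occRun_loc_copyR_of_ne hij.ne, Option.bind_some, hm]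
      exact ih (by omega)
    | _ => simp [bulletR, occRun, occStep, (loc_ne_glob _ _ _).symm, ih hij]

theorem occRun_loc_bulletR (A : List RTok) (i a j : ℕ) (S : List RTok) (s : ℕ) :
    occRun (loc i a) (bulletR A j S) s = some s ∨
      occRun (loc i a) (bulletR A j S) s = occRun a A s := by
  induction S generalizing j with
  | nil => exact Or.inl rfl
  | cons u S ih =>
    cases u with
    | blk bs =>
      have hm : ∀ s, occRun (loc i a) (bs.reverse.map fun b => RTok.mid (glob b)) s = some s :=
        fun s => occRun_map_mid _ _ _ _ fun c _ h => absurd h.symm (loc_ne_glob i a c)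
      by_cases hij : i = j
      · subst hij
        right
        simp only [bulletR, occRun_append, occRun_loc_copyR]
        cases occRun a A s with
        | none => rfl
        | some t =>
          simp only [Option.bind_some, hm, occRun_loc_bulletR_of_lt A (Nat.lt_succ_self i)]
      · simp only [bulletR, occRun_append, occRun_loc_copyR_of_ne hij, Option.bind_some, hm]
        exact ih (j + 1)
    | _ => simpa [bulletR, occRun, occStep, (loc_ne_glob _ _ _).symm] using ih j

theorem WellMarked.bulletR {A S : List RTok} (hA : WellMarked A) (hS : WellMarked S)
    (hlen : BlockLen (nbs A) S) : WellMarked (bulletR A 0 S) := by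
  intro n
  rcases exists_loc_or_glob n with ⟨i, a, rfl⟩ | ⟨b, rfl⟩
  · rcases occRun_loc_bulletR A i a 0 S 0 with h | h
    · exact Or.inl h
    · rw [h]; exact hA a
  · exact (hS b).imp (occRun_glob_bulletR A b S hlen 0 0 _) (occRun_glob_bulletR A b S hlen 0 0 _)

theorem occRun_map_blk (a : ℕ) (bs : List ℕ) (s t : ℕ) (h : occStep a (RTok.blk bs) s = some t) :
    occRun a (bs.map fun b => RTok.blk [b]) s = some t := by
  induction bs generalizing s with
  | nil => simpa [occStep, occRun] using h
  | cons b bs ih =>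
    by_cases hb : b = a
    · subst hb
      simp only [occStep, List.mem_cons_self, if_true, List.count_cons_self] at h
      split_ifs at h with h'
      have hmem : b ∉ bs := List.count_eq_zero.1 (by omega)
      have := ih 1 (by simpa [occStep, hmem] using h)
      simp [occRun, occStep, this, h'.1]
    · have := ih s (by simpa [occStep, List.count_cons_of_ne hb, Ne.symm hb] using h)
      simp [occRun, occStep, this, Ne.symm hb]

theorem occRun_splitR (a : ℕ) (S : List RTok) (s t : ℕ) (h : occRun a S s = some t) :
    occRun a (splitR S) s = some t := by
  induction S generalizing s with
  | nil => exact h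
  | cons u S ih =>
    simp only [occRun, Option.bind_eq_some_iff] at h
    obtain ⟨s', h1, h2⟩ := h
    have ih := ih s' h2
    cases u with
    | blk bs =>
      have hm : occRun a (bs.dropLast.reverse.map RTok.mid) s' = some s' := by
        refine occRun_map_mid a id _ _ fun c hc hca => ?_
        obtain rfl : c = a := hca
        have hc : c ∈ bs := List.mem_of_mem_dropLast (List.mem_reverse.1 hc)
        simp only [occStep, hc, if_true] at h1
        split_ifs at h1
        simpa using h1.symm
      simp only [splitR, occRun_append, occRun_map_blk a bs s s' h1, Option.bind_some, hm, ih]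
    | _ => simp [splitR, occRun, h1, ih]

theorem WellMarked.splitR {S : List RTok} (hS : WellMarked S) : WellMarked (splitR S) :=
  fun a => (hS a).imp (occRun_splitR a S 0 _) (occRun_splitR a S 0 _)

theorem wellMarked_HSR (k m : ℕ) : WellMarked (HSR k m) := by
  induction k generalizing m with
  | zero =>
    induction m with
    | zero =>
      intro a
      by_cases h1 : a = 1
      · subst h1; simp [HSR, occRun, occStep]
      by_cases h2 : a = 2
      · subst h2; simp [HSR, occRun, occStep]
      simp [HSR, occRun, occStep, h1, h2, Ne.symm h1, Ne.symm h2]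
    | succ m ih =>
      intro n
      rw [HSR]
      rcases exists_loc_or_glob n with ⟨i, a, rfl⟩ | ⟨b, rfl⟩
      · simp only [occRun_append]
        have h : ∀ s, occRun (loc i a) [RTok.mid (glob 2), RTok.last (glob 1),
            RTok.last (glob 2)] s = some s := by
          simp [occRun, occStep, (loc_ne_glob _ _ _).symm]
        by_cases hi : i = 0
        · subst hi
          rw [occRun_loc_copyR]
          rcases ih a with h' | h' <;> simp [h', h]
        · simp [occRun_loc_copyR_of_ne hi, h]
      · have hc := occRun_glob_copyR 0 b (HSR 0 m) [1, 2] (by simp [nbs_HSR_zero]) 0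
        simp only [occRun_append]
        by_cases h1 : b = 1
        · subst h1
          rw [hc 1 (by simp [occStep])]
          simp [occRun, occStep, glob_inj]
        by_cases h2 : b = 2
        · subst h2
          rw [hc 1 (by simp [occStep])]
          simp [occRun, occStep, glob_inj]
        rw [hc 0 (by simp [occStep, h1, h2])]
        simp [occRun, occStep, glob_inj, Ne.symm h1, Ne.symm h2]
  | succ k ihk =>
    induction m with
    | zero => rw [HSR]; exact (ihk 1).splitR
    | succ m ih =>
      rw [HSR]
      have hb := blockLen_HSR k (nbs (HSR (k + 1) m) - 1)
      rw [Nat.sub_add_cancel (by have := two_le_nbs_HSR (k + 1) m; omega)] at hb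
      exact ih.bulletR (ihk _) hb

/-! ### Events of a marked sequence -/

/-- An occurrence of a symbol: the first, a middle, or the last one. -/
inductive Ev : Type where
  | L : ℕ → Ev
  | M : ℕ → Ev
  | R : ℕ → Ev
deriving DecidableEq

namespace Ev

/-- The symbol of an event. -/
def sym : Ev → ℕ
  | L a => a
  | M a => a
  | R a => a

/-- The endpoint coordinate of an event. -/
def coord (xL xR : ℕ → ℝ) : Ev → Option ℝ
  | L a => some (xL a)
  | M _ => none
  | R a => some (xR a)

/-- Relabeling of the symbol of an event. -/
def map (f : ℕ → ℕ) : Ev → Ev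
  | L a => L (f a)
  | M a => M (f a)
  | R a => R (f a)

end Ev

/-- The events of a marked token. -/
def RTok.evs : RTok → List Ev
  | mid a => [Ev.M a]
  | last a => [Ev.R a]
  | blk bs => bs.map Ev.L ++ bs.dropLast.reverse.map Ev.M

/-- The events of a marked sequence. -/
def evs (S : List RTok) : List Ev := S.flatMap RTok.evs

@[simp] theorem evs_cons (t : RTok) (S : List RTok) : evs (t :: S) = t.evs ++ evs S := rfl

theorem symsOf_append (S T : List Tok) : symsOf (S ++ T) = symsOf S ++ symsOf T := by
  induction S with
  | nil => rfl
  | cons t S ih => cases t <;> simp [symsOf, ih]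

theorem symsOf_map_sym (l : List ℕ) : symsOf (l.map Tok.sym) = l := by
  induction l with
  | nil => rfl
  | cons t S ih => simp [symsOf, ih]

theorem symsOf_toToks (S : List RTok) : symsOf (toToks S) = (evs S).map Ev.sym := by
  have h1 : Ev.sym ∘ Ev.L = id := rfl
  have h2 : Ev.sym ∘ Ev.M = id := rfl
  induction S with
  | nil => rfl
  | cons t S ih =>
    cases t with
    | blk bs =>
      simp only [toToks_cons, RTok.toTok, symsOf_append, ih, evs_cons, RTok.evs, List.map_append,
        List.map_map, h1, h2, List.map_id, symsOf, symsOf_map_sym, List.cons_append]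
    | _ => simp [RTok.toTok, symsOf, ih, RTok.evs, Ev.sym]

theorem mem_symsOf_toToks {a : ℕ} {t : RTok} {S : List RTok} :
    a ∈ symsOf (toToks (t :: S)) ↔ a ∈ symsOf t.toTok ∨ a ∈ symsOf (toToks S) := by
  rw [toToks_cons, symsOf_append, List.mem_append]

theorem occStep_of_notMem {a : ℕ} {t : RTok} (h : a ∉ symsOf t.toTok) (s : ℕ) :
    occStep a t s = some s := by
  cases t with
  | blk bs =>
    have : a ∉ bs := by
      simp only [RTok.toTok, symsOf, symsOf_append, symsOf_map_sym, List.mem_append, not_or] at h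
      exact h.1
    simp [occStep, this]
  | _ =>
    simp only [RTok.toTok, symsOf, List.mem_singleton] at h
    simp [occStep, Ne.symm h]

theorem occRun_of_notMem {a : ℕ} {S : List RTok} (h : a ∉ symsOf (toToks S)) (s : ℕ) :
    occRun a S s = some s := by
  induction S with
  | nil => rfl
  | cons t S ih =>
    rw [mem_symsOf_toToks, not_or] at h
    simp [occRun, occStep_of_notMem h.1, ih h.2]

theorem notMem_of_occRun_two {a t : ℕ} {S : List RTok} (h : occRun a S 2 = some t) :
    a ∉ symsOf (toToks S) := by
  induction S with
  | nil => simp [symsOf]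
  | cons u S ih =>
    simp only [occRun, Option.bind_eq_some_iff] at h
    obtain ⟨s', h1, h2⟩ := h
    have hn : a ∉ symsOf u.toTok := by
      intro hmem
      cases u with
      | blk bs =>
        have hm : a ∈ bs := by
          simp only [RTok.toTok, symsOf, symsOf_append, symsOf_map_sym, List.mem_append] at hmem
          exact hmem.elim id fun h => List.mem_of_mem_dropLast (List.mem_reverse.1 h)
        simp [occStep, hm] at h1
      | _ =>
        simp only [RTok.toTok, symsOf, List.mem_singleton] at hmem
        simp [occStep, hmem] at h1
    rw [occStep_of_notMem hn, Option.some_inj] at h1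
    subst h1
    rw [mem_symsOf_toToks, not_or]
    exact ⟨hn, ih h2⟩

theorem EAux_first (bs : List ℕ) (hbs : bs.Nodup) (seen : List ℕ) (hseen : ∀ b ∈ bs, b ∉ seen)
    (r : List Tok) :
    EAux seen (bs.map Tok.sym ++ r) = bs.map ETok.L ++ EAux (bs.reverse ++ seen) r := by
  induction bs generalizing seen with
  | nil => rfl
  | cons b bs ih =>
    rw [List.nodup_cons] at hbs
    have h1 := hseen b (by simp)
    have h2 := ih hbs.2 (b :: seen) (by
      intro c hc
      simp only [List.mem_cons, not_or]
      exact ⟨fun h => hbs.1 (h ▸ hc), hseen c (by simp [hc])⟩)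
    simp [EAux, h1, h2]

theorem EAux_mid (l seen : List ℕ) (r : List Tok)
    (h : ∀ b ∈ l, b ∈ seen ∧ b ∈ symsOf r) : EAux seen (l.map Tok.sym ++ r) = EAux seen r := by
  induction l with
  | nil => rfl
  | cons b l ih =>
    have hb := h b (by simp)
    have ih := ih fun c hc => h c (by simp [hc])
    simp only [List.map_cons, List.cons_append, EAux, hb.1, if_true, ih, symsOf_append,
      List.mem_append, hb.2, or_true]

theorem coordList_EAux (xL xR : ℕ → ℝ) (S : List RTok) (seen : List ℕ)
    (h : ∀ a, ∃ s t, (a ∈ seen ↔ s ≠ 0) ∧ occRun a S s = some t ∧ (t = 0 ∨ t = 2)) :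
    coordList xL xR (EAux seen (toToks S)) = (evs S).filterMap (Ev.coord xL xR) := by
  induction S generalizing seen with
  | nil => rfl
  | cons u S ih =>
    have later : ∀ {a t : ℕ}, occRun a S 1 = some t → (t = 0 ∨ t = 2) →
        a ∈ symsOf (toToks S) := by
      intro a t h1 h2
      by_contra hn
      rw [occRun_of_notMem hn, Option.some_inj] at h1
      omega
    cases u with
    | mid a =>
      have ih := ih seen fun b => by
        obtain ⟨s, t, h1, h2, h3⟩ := h b
        simp only [occRun, Option.bind_eq_some_iff] at h2
        obtain ⟨s', h4, h5⟩ := h2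
        refine ⟨s', t, ?_, h5, h3⟩
        simp only [occStep] at h4
        split_ifs at h4 <;> simp at h4 <;> simp [h1] <;> omega
      obtain ⟨s, t, h1, h2, h3⟩ := h a
      simp only [occRun, Option.bind_eq_some_iff, occStep, if_true] at h2
      obtain ⟨s', h4, h5⟩ := h2
      split_ifs at h4 with hs
      obtain rfl : 1 = s' := by simpa using h4
      have hl := later h5 h3
      have hseen : a ∈ seen := by rw [h1, hs]; simp
      simp only [toToks_cons, RTok.toTok, List.cons_append, List.nil_append, EAux, hseen, hl,
        if_true, ih, evs_cons, RTok.evs, List.filterMap_cons, Ev.coord]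
    | last a =>
      have ih := ih seen fun b => by
        obtain ⟨s, t, h1, h2, h3⟩ := h b
        simp only [occRun, Option.bind_eq_some_iff] at h2
        obtain ⟨s', h4, h5⟩ := h2
        refine ⟨s', t, ?_, h5, h3⟩
        simp only [occStep] at h4
        split_ifs at h4 <;> simp at h4 <;> simp [h1] <;> omega
      obtain ⟨s, t, h1, h2, h3⟩ := h a
      simp only [occRun, Option.bind_eq_some_iff, occStep, if_true] at h2
      obtain ⟨s', h4, h5⟩ := h2
      split_ifs at h4 with hs
      obtain rfl : 2 = s' := by simpa using h4
      have hl := notMem_of_occRun_two h5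
      have hseen : a ∈ seen := by rw [h1, hs]; simp
      simp only [toToks_cons, RTok.toTok, List.cons_append, List.nil_append, EAux, hseen, hl,
        if_true, if_false, evs_cons, RTok.evs, List.filterMap_cons, Ev.coord, ← ih]
      simp [coordList]
    | blk bs =>
      have key : ∀ b ∈ bs, b ∉ seen ∧ bs.count b = 1 ∧ b ∈ symsOf (toToks S) := by
        intro b hb
        obtain ⟨s, t, h1, h2, h3⟩ := h b
        simp only [occRun, Option.bind_eq_some_iff, occStep, hb, if_true] at h2
        obtain ⟨s', h4, h5⟩ := h2
        split_ifs at h4 with hs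
        obtain rfl : 1 = s' := by simpa using h4
        exact ⟨by rw [h1, hs.1]; simp, hs.2, later h5 h3⟩
      have ih := ih (bs.reverse ++ seen) fun b => by
        obtain ⟨s, t, h1, h2, h3⟩ := h b
        simp only [occRun, Option.bind_eq_some_iff] at h2
        obtain ⟨s', h4, h5⟩ := h2
        refine ⟨s', t, ?_, h5, h3⟩
        simp only [occStep] at h4
        split_ifs at h4 with hb <;> simp at h4
        · simp [hb, ← h4]
        · simp [hb, ← h4, h1]
      have hnd : bs.Nodup := by
        rw [List.nodup_iff_count_le_one]
        intro b
        by_cases hb : b ∈ bs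
        · exact (key b hb).2.1.le
        · simp [List.count_eq_zero.2 hb]
      have hmid : ∀ b ∈ bs.dropLast.reverse, b ∈ bs.reverse ++ seen ∧ b ∈ symsOf (toToks S) := by
        intro b hb
        have hb := List.mem_of_mem_dropLast (List.mem_reverse.1 hb)
        exact ⟨by simp [hb], (key b hb).2.2⟩
      have hL : ∀ l : List ℕ, coordList xL xR (l.map ETok.L) =
          (l.map Ev.L).filterMap (Ev.coord xL xR) := by
        intro l
        simp [coordList, List.filterMap_map, Function.comp_def, Ev.coord]
      have hM : ∀ l : List ℕ, (l.map Ev.M).filterMap (Ev.coord xL xR) = [] := by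
        intro l
        simp [List.filterMap_map, Function.comp_def, Ev.coord]
      have happ : ∀ U V : List ETok, coordList xL xR (U ++ V) =
          coordList xL xR U ++ coordList xL xR V := by
        intro U V
        simp [coordList]
      have hop : ∀ V : List ETok, coordList xL xR (ETok.op :: V) = coordList xL xR V := by
        intro V; simp [coordList]
      have hcl : ∀ V : List ETok, coordList xL xR (ETok.cl :: V) = coordList xL xR V := by
        intro V; simp [coordList]
      simp only [toToks_cons, RTok.toTok, List.cons_append, List.append_assoc, EAux,
        EAux_first bs hnd seen (fun b hb => (key b hb).1), EAux_mid _ _ _ hmid, hop, hcl, happ, hL,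
        evs_cons, RTok.evs, List.filterMap_append, hM, List.nil_append, ih]

theorem coordList_Efun (xL xR : ℕ → ℝ) {S : List RTok} (hS : WellMarked S) :
    coordList xL xR (Efun (toToks S)) = (evs S).filterMap (Ev.coord xL xR) :=
  coordList_EAux xL xR S [] fun a =>
    (hS a).elim (fun h => ⟨0, 0, by simp, h, Or.inl rfl⟩) fun h => ⟨0, 2, by simp, h, Or.inr rfl⟩

/-! ### Patterns

A pattern is a list of events and of special blocks.  The entries of a special block
of a pattern stand for symbols at prescribed positions of a special block of a marked
sequence; the entry `none` stands for an unspecified symbol. -/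

/-- Tokens of a pattern. -/
inductive QTok : Type where
  | L : ℕ → QTok
  | M : ℕ → QTok
  | R : ℕ → QTok
  | B : List (Option ℕ) → QTok

/-- The symbols `as` of a pattern block occur in `bs` at the positions given by `ρ`. -/
def Sel (φ ρ : ℕ → ℕ) (as : List (Option ℕ)) (bs : List ℕ) : Prop :=
  ∀ t a : ℕ, as[t]? = some (some a) → bs[ρ t]? = some (φ a)

/-- `Emb φ ρ n P S σ`: the pattern `P` embeds into the marked sequence `S`, mapping
symbols by `φ` and positions in special blocks by `ρ`; the special blocks of `S` are
numbered from `n` on, and `σ` lists the numbers of the blocks used for those of `P`. -/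
inductive Emb (φ ρ : ℕ → ℕ) : ℕ → List QTok → List RTok → List ℕ → Prop
  | nil (n : ℕ) (S : List RTok) : Emb φ ρ n [] S []
  | skip {n : ℕ} {P : List QTok} {S : List RTok} {σ : List ℕ} (t : RTok) :
      Emb φ ρ (n + t.nb) P S σ → Emb φ ρ n P (t :: S) σ
  | mid {n : ℕ} {P : List QTok} {S : List RTok} {σ : List ℕ} (a : ℕ) :
      Emb φ ρ n P S σ → Emb φ ρ n (QTok.M a :: P) (RTok.mid (φ a) :: S) σ
  | last {n : ℕ} {P : List QTok} {S : List RTok} {σ : List ℕ} (a : ℕ) :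
      Emb φ ρ n P S σ → Emb φ ρ n (QTok.R a :: P) (RTok.last (φ a) :: S) σ
  | left {n : ℕ} {P : List QTok} {S : List RTok} {σ : List ℕ} {a : ℕ} {bs : List ℕ} :
      φ a ∈ bs → Emb φ ρ (n + 1) P S σ → Emb φ ρ n (QTok.L a :: P) (RTok.blk bs :: S) σ
  | block {n : ℕ} {P : List QTok} {S : List RTok} {σ : List ℕ} {as : List (Option ℕ)}
      {bs : List ℕ} : Sel φ ρ as bs → Emb φ ρ (n + 1) P S σ →
      Emb φ ρ n (QTok.B as :: P) (RTok.blk bs :: S) (n :: σ)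

/-- The special blocks of the pattern `P`. -/
def slots : List QTok → List (List (Option ℕ))
  | [] => []
  | QTok.B as :: P => as :: slots P
  | _ :: P => slots P

/-- All special blocks of the pattern `P` have length `s`. -/
def SlotLen (s : ℕ) (P : List QTok) : Prop := ∀ as ∈ slots P, as.length = s

instance (s : ℕ) (P : List QTok) : Decidable (SlotLen s P) :=
  inferInstanceAs (Decidable (∀ as ∈ slots P, as.length = s))

theorem Emb.append {φ ρ : ℕ → ℕ} {n : ℕ} {P Q : List QTok} {X S : List RTok} {σ τ : List ℕ}
    (h : Emb φ ρ n P X σ) (h' : Emb φ ρ (n + nbs X) Q S τ) :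
    Emb φ ρ n (P ++ Q) (X ++ S) (σ ++ τ) := by
  induction h with
  | nil n X =>
    induction X generalizing n with
    | nil => exact h'
    | cons t X ih =>
      refine Emb.skip t (ih (n + t.nb) ?_)
      rwa [add_assoc]
  | skip t _ ih =>
    refine Emb.skip t (ih ?_)
    rwa [add_assoc]
  | mid a _ ih => exact Emb.mid a (ih (by simpa [RTok.nb] using h'))
  | last a _ ih => exact Emb.last a (ih (by simpa [RTok.nb] using h'))
  | left ha _ ih =>
    refine Emb.left ha (ih ?_)
    rwa [add_assoc]
  | block hs _ ih =>
    refine Emb.block hs (ih ?_)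
    rwa [add_assoc]

theorem Emb.skip_append {φ ρ : ℕ → ℕ} {n : ℕ} {P : List QTok} {S : List RTok} {σ : List ℕ}
    (X : List RTok) (h : Emb φ ρ (n + nbs X) P S σ) : Emb φ ρ n P (X ++ S) σ :=
  (Emb.nil n X).append h

theorem Emb.append_right {φ ρ : ℕ → ℕ} {n : ℕ} {P : List QTok} {X : List RTok} {σ : List ℕ}
    (h : Emb φ ρ n P X σ) (S : List RTok) : Emb φ ρ n P (X ++ S) σ := by
  simpa using h.append (Emb.nil _ S)

theorem Emb.slots_spec {φ ρ : ℕ → ℕ} {n : ℕ} {P : List QTok} {S : List RTok} {σ : List ℕ}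
    (h : Emb φ ρ n P S σ) :
    σ.length = (slots P).length ∧ σ.Pairwise (· < ·) ∧ ∀ j ∈ σ, n ≤ j ∧ j < n + nbs S := by
  induction h with
  | nil => simp [slots]
  | skip t _ ih =>
    refine ⟨ih.1, ih.2.1, fun j hj => ?_⟩
    have := ih.2.2 j hj
    rw [nbs_cons]
    omega
  | left ha _ ih =>
    refine ⟨ih.1, ih.2.1, fun j hj => ?_⟩
    have := ih.2.2 j hj
    rw [nbs_cons, RTok.nb]
    omega
  | block hs _ ih =>
    refine ⟨by simp [slots, ih.1], ?_, fun j hj => ?_⟩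
    · rw [List.pairwise_cons]
      exact ⟨fun j hj => (ih.2.2 j hj).1, ih.2.1⟩
    · rw [nbs_cons, RTok.nb]
      rcases List.mem_cons.1 hj with rfl | hj
      · omega
      · have := ih.2.2 j hj
        omega
  | _ _ _ ih => simpa [slots, RTok.nb] using ih

theorem Sel.sublist {φ ρ : ℕ → ℕ} (hρ : StrictMono ρ) {as : List (Option ℕ)} {bs : List ℕ}
    (h : Sel φ ρ as bs) : ((as.filterMap id).map φ).Sublist bs := by
  induction as generalizing ρ bs with
  | nil => simp
  | cons a as ih =>
    cases a with
    | none =>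
      exact ih (ρ := fun t => ρ (t + 1)) (fun x y hxy => hρ (by omega))
        fun t a ht => h (t + 1) a (by simpa using ht)
    | some a =>
      have h0 := h 0 a (by simp)
      obtain ⟨hlt, hget⟩ := List.getElem?_eq_some_iff.1 h0
      have hdec : bs = bs.take (ρ 0) ++ φ a :: bs.drop (ρ 0 + 1) := by
        rw [← hget, List.getElem_cons_drop, List.take_append_drop]
      have hmono : ∀ t, ρ 0 + 1 ≤ ρ (t + 1) := fun t => hρ (Nat.succ_pos t)
      have hrest : ((as.filterMap id).map φ).Sublist (bs.drop (ρ 0 + 1)) := by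
        refine ih (ρ := fun t => ρ (t + 1) - (ρ 0 + 1)) ?_ fun t a ht => ?_
        · intro x y hxy
          have h1 : ρ (x + 1) < ρ (y + 1) := hρ (by omega)
          have h2 := hmono x
          simp only
          omega
        · rw [List.getElem?_drop, Nat.add_sub_cancel' (hmono t)]
          exact h (t + 1) a (by simpa using ht)
      rw [hdec]
      simpa using (hrest.cons_cons (φ a)).trans (List.sublist_append_right _ _)

/-! ### Shuffles of patterns -/

/-- The `i`-th copy of a pattern, with the entries of `ds` appended to its blocks. -/
def copyQ (i : ℕ) : List QTok → List (Option ℕ) → List QTok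
  | [], _ => []
  | QTok.L a :: P, ds => QTok.L (loc i a) :: copyQ i P ds
  | QTok.M a :: P, ds => QTok.M (loc i a) :: copyQ i P ds
  | QTok.R a :: P, ds => QTok.R (loc i a) :: copyQ i P ds
  | QTok.B as :: P, ds =>
      QTok.B (as.map (Option.map (loc i)) ++ [ds.head?.join.map glob]) :: copyQ i P ds.tail

/-- The shuffle of patterns. -/
def bulletQ (P : List QTok) : ℕ → List QTok → List QTok
  | _, [] => []
  | i, QTok.L a :: Q => QTok.L (glob a) :: bulletQ P i Q
  | i, QTok.M a :: Q => QTok.M (glob a) :: bulletQ P i Q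
  | i, QTok.R a :: Q => QTok.R (glob a) :: bulletQ P i Q
  | i, QTok.B as :: Q =>
      copyQ i P as ++ ((as.filterMap id).reverse.map fun a => QTok.M (glob a)) ++
        bulletQ P (i + 1) Q

theorem slots_append (P Q : List QTok) : slots (P ++ Q) = slots P ++ slots Q := by
  induction P with
  | nil => rfl
  | cons p P ih => cases p <;> simp [slots, ih]

theorem slots_map_M (l : List ℕ) : slots (l.map fun a => QTok.M (glob a)) = [] := by
  induction l with
  | nil => rfl
  | cons a l ih => simpa [slots] using ih

theorem SlotLen.copyQ {s : ℕ} {P : List QTok} (hP : SlotLen s P) (i : ℕ)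
    (ds : List (Option ℕ)) : SlotLen (s + 1) (copyQ i P ds) := by
  induction P generalizing ds with
  | nil => simp [_root_.copyQ, SlotLen, slots]
  | cons p P ih =>
    cases p with
    | B as =>
      have hP : ∀ bs ∈ as :: slots P, bs.length = s := hP
      intro bs hbs
      rcases List.mem_cons.1 hbs with rfl | hbs
      · simp [hP as (by simp)]
      · exact ih (fun cs hcs => hP cs (by simp [hcs])) ds.tail bs hbs
    | _ => exact ih hP ds

theorem SlotLen.bulletQ {s : ℕ} {P : List QTok} (hP : SlotLen s P) (i : ℕ) (Q : List QTok) :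
    SlotLen (s + 1) (bulletQ P i Q) := by
  induction Q generalizing i with
  | nil => simp [_root_.bulletQ, SlotLen, slots]
  | cons q Q ih =>
    cases q with
    | B as =>
      intro bs hbs
      simp only [_root_.bulletQ, slots_append, slots_map_M, List.append_nil, List.mem_append] at hbs
      exact hbs.elim (hP.copyQ i as bs) (ih (i + 1) bs)
    | _ => exact ih i

theorem Emb.copyR {φ φ' ψ ρ : ℕ → ℕ} {n : ℕ} {P : List QTok} {A : List RTok} {σ : List ℕ}
    (h : Emb φ ρ n P A σ) {s i I : ℕ} (hP : SlotLen s P) (hA : BlockLen (ρ s) A)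
    (C : List ℕ) (ds : List (Option ℕ)) (off : ℕ)
    (hds : ∀ t d : ℕ, ds[t]? = some (some d) → ∃ j : ℕ, σ[t]? = some j ∧ C[j]? = some (ψ d))
    (hloc : ∀ a, φ' (loc i a) = loc I (φ a)) (hglob : ∀ d, φ' (glob d) = glob (ψ d)) :
    Emb φ' ρ (off + n) (copyQ i P ds) (copyR I A (C.drop n)) (σ.map (off + ·)) := by
  induction h generalizing ds with
  | nil => exact Emb.nil _ _
  | skip t _ ih =>
    have ih := ih hP hA.tail ds hds
    cases t with
    | blk bs =>
      refine Emb.skip _ ?_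
      rw [List.tail_drop]
      exact ih
    | _ => exact Emb.skip _ ih
  | mid a _ ih =>
    have ih := Emb.mid (loc i a) (ih hP hA.tail ds hds)
    rw [hloc] at ih
    exact ih
  | last a _ ih =>
    have ih := Emb.last (loc i a) (ih hP hA.tail ds hds)
    rw [hloc] at ih
    exact ih
  | @left n P S σ a bs ha _ ih =>
    have ih := ih hP hA.tail ds hds
    refine Emb.left ?_ ?_
    · rw [hloc]
      exact List.mem_append_left _ (List.mem_map_of_mem ha)
    · rw [List.tail_drop]
      exact ih
  | @block n P S σ as bs hs _ ih =>
    have hP : ∀ cs ∈ as :: slots P, cs.length = s := hP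
    have has := hP as (by simp)
    have hbs := hA bs (by simp)
    have ih := ih (fun cs hcs => hP cs (by simp [hcs])) hA.tail ds.tail (fun t d htd => by
      simpa using hds (t + 1) d (by simpa using htd))
    refine Emb.block ?_ ?_
    · intro t a hta
      rcases lt_or_ge t s with ht | ht
      · rw [List.getElem?_append_left (by simpa [has] using ht), List.getElem?_map] at hta
        simp only [Option.map_eq_some_iff] at hta
        obtain ⟨x, hx, y, rfl, rfl⟩ := hta
        have hb := hs t y hx
        obtain ⟨hlt, -⟩ := List.getElem?_eq_some_iff.1 hb
        rw [List.getElem?_append_left (by simpa using hlt), List.getElem?_map, hb, hloc]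
        rfl
      · rw [List.getElem?_append_right (by simpa [has] using ht)] at hta
        have ht' : t = s := by
          obtain ⟨hlt, -⟩ := List.getElem?_eq_some_iff.1 hta
          simp [has] at hlt
          omega
        subst ht'
        simp only [List.length_map, has, Nat.sub_self, List.getElem?_cons_zero, Option.some_inj,
          Option.map_eq_some_iff] at hta
        obtain ⟨d, hd, rfl⟩ := hta
        have hd0 : ds[0]? = some (some d) := by
          cases ds with
          | nil => simp at hd
          | cons x ds => simpa using hd
        obtain ⟨j, hj, hC⟩ := hds 0 d hd0
        obtain rfl : n = j := by simpa using hj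
        rw [List.getElem?_append_right (by simp [hbs]), hglob]
        simp [hbs, hC]
    · rw [List.tail_drop]
      exact ih

theorem Emb.left_copyR {φ ρ : ℕ → ℕ} {a b : ℕ} (i : ℕ) {A : List RTok} {bs : List ℕ}
    (hA : bs.length ≤ nbs A) (hb : b ∈ bs) (ha : φ a = glob b) (n : ℕ) :
    Emb φ ρ n [QTok.L a] (_root_.copyR i A bs) [] := by
  induction A generalizing bs n with
  | nil => simp at hA; simp [hA] at hb
  | cons t A ih =>
    cases t with
    | blk cs =>
      cases bs with
      | nil => simp at hb
      | cons c bs =>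
        by_cases hc : b = c
        · subst hc
          exact Emb.left (by simp [ha]) (Emb.nil _ _)
        · refine Emb.skip _ (ih ?_ ((List.mem_cons.1 hb).resolve_left hc) _)
          simp [RTok.nb] at hA
          omega
    | _ => exact Emb.skip _ (ih (by simpa [RTok.nb] using hA) hb _)

theorem Emb.mids {φ ψ ρ : ℕ → ℕ} (n : ℕ) {l l' : List ℕ} (h : (l.map φ).Sublist l')
    (hglob : ∀ d, ψ (glob d) = glob (φ d)) :
    Emb ψ ρ n (l.map fun a => QTok.M (glob a)) (l'.map fun b => RTok.mid (glob b)) [] := by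
  induction l' generalizing l with
  | nil =>
    obtain rfl : l = [] := by simpa using h
    exact Emb.nil _ _
  | cons b l' ih =>
    cases l with
    | nil => exact Emb.nil _ _
    | cons a l =>
      rw [List.map_cons] at h
      rcases List.sublist_cons_iff.1 h with h | ⟨r, hr, h⟩
      · exact Emb.skip _ (ih (l := a :: l) h)
      · obtain ⟨rfl, rfl⟩ := List.cons.inj hr
        rw [List.map_cons, List.map_cons, ← hglob]
        exact Emb.mid _ (ih h)

theorem Emb.bulletR {φ φP φ' ρ ρ' : ℕ → ℕ} {n : ℕ} {P Q : List QTok} {A S : List RTok}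
    {σ τ : List ℕ} (hQ : Emb φ ρ n Q S τ) (hP : Emb φP ρ' 0 P A σ) {s s' : ℕ}
    (hPlen : SlotLen s P) (hA : BlockLen (ρ' s) A) (hQlen : SlotLen s' Q)
    (hS : BlockLen (nbs A) S) (hρ : StrictMono ρ)
    (hσ : ∀ t < s', σ[t]? = some (ρ t)) (i : ℕ)
    (hloc : ∀ j I, τ[j]? = some I → ∀ a, φ' (loc (i + j) a) = loc I (φP a))
    (hglob : ∀ d, φ' (glob d) = glob (φ d)) :
    Emb φ' ρ' (n * nbs A) (bulletQ P i Q) (bulletR A n S)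
      (τ.flatMap fun I => σ.map (I * nbs A + ·)) := by
  have hM : ∀ (f : ℕ → ℕ) (l : List ℕ), nbs (l.map fun b => RTok.mid (f b)) = 0 :=
    fun f l => nbs_map_mid f l
  induction hQ generalizing i with
  | nil => exact Emb.nil _ _
  | @skip n Q S τ t _ ih =>
    have ih := ih hQlen hS.tail i hloc
    cases t with
    | blk bs =>
      refine Emb.skip_append _ ?_
      rw [nbs_append, nbs_copyR, hM, add_zero, ← Nat.succ_mul]
      exact ih
    | _ => exact Emb.skip _ ih
  | mid a _ ih =>
    have ih := Emb.mid (glob a) (ih hQlen hS.tail i hloc)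
    rw [hglob] at ih
    exact ih
  | last a _ ih =>
    have ih := Emb.last (glob a) (ih hQlen hS.tail i hloc)
    rw [hglob] at ih
    exact ih
  | @left n Q S τ a bs ha _ ih =>
    have ih := ih hQlen hS.tail i hloc
    have h1 := Emb.left_copyR (ρ := ρ') (a := glob a) n (hS bs (by simp)).le ha (hglob a)
      (n * nbs A)
    refine (h1.append_right _).append ?_
    rw [nbs_append, nbs_copyR, hM, add_zero, ← Nat.succ_mul]
    exact ih
  | @block n Q S τ as bs hs _ ih =>
    have hQlen : ∀ cs ∈ as :: slots Q, cs.length = s' := hQlen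
    have ih := ih (fun cs hcs => hQlen cs (by simp [hcs])) hS.tail (i + 1) fun j I hj a => by
      rw [add_assoc, add_comm 1 j]
      exact hloc (j + 1) I (by simpa using hj) a
    have h1 := hP.copyR (i := i) (I := n) (φ' := φ') (ψ := φ) hPlen hA bs as (n * nbs A)
      (fun t d htd => by
        refine ⟨ρ t, hσ t ?_, hs t d htd⟩
        obtain ⟨hlt, -⟩ := List.getElem?_eq_some_iff.1 htd
        rwa [hQlen as (by simp)] at hlt)
      (fun a => hloc 0 n (by simp) a) hglob
    have h2 : ((as.filterMap id).reverse.map φ).Sublist bs.reverse := by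
      rw [List.map_reverse]
      exact (hs.sublist hρ).reverse
    rw [List.drop_zero] at h1
    have h3 := h1.append (Emb.mids (n * nbs A + 0 + nbs (_root_.copyR n A bs)) h2 hglob)
    rw [List.append_nil] at h3
    refine h3.append ?_
    rw [nbs_append, nbs_copyR, hM, add_zero, add_zero, ← Nat.succ_mul]
    exact ih

/-! ### Patterns forced in the Hart–Sharir sequences -/

/-- The pattern `P`, with special blocks of length `s`, embeds into `HSR k m` for all
large `m`, with the blocks of `P` numbered at least `c` and with their entries at
arbitrarily prescribed positions, as long as these are large enough. -/
def Forced (k c s : ℕ) (P : List QTok) : Prop :=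
  SlotLen s P ∧ ∃ r₀, ∀ ρ : ℕ → ℕ, StrictMono ρ → r₀ ≤ ρ 0 → ∀ m, r₀ ≤ m → (∀ t < s, ρ t ≤ m) →
    ∃ φ σ, Emb φ ρ 0 P (HSR k m) σ ∧ ∀ j ∈ σ, c ≤ j

theorem Emb.loc_copyR {φ ρ : ℕ → ℕ} {n : ℕ} {P : List QTok} {A : List RTok} {σ : List ℕ}
    (h : Emb φ ρ n P A σ) (i : ℕ) (cs : List ℕ) :
    Emb (fun a => loc i (φ a)) ρ n P (_root_.copyR i A cs) σ := by
  induction h generalizing cs with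
  | nil => exact Emb.nil _ _
  | skip t _ ih => cases t <;> exact Emb.skip _ (ih _)
  | mid a _ ih => exact Emb.mid a (ih _)
  | last a _ ih => exact Emb.last a (ih _)
  | left ha _ ih => exact Emb.left (List.mem_append_left _ (List.mem_map_of_mem ha)) (ih _)
  | block hs _ ih =>
    refine Emb.block (fun t a hta => ?_) (ih _)
    have hb := hs t a hta
    obtain ⟨hlt, -⟩ := List.getElem?_eq_some_iff.1 hb
    rw [List.getElem?_append_left (by simpa using hlt), List.getElem?_map, hb]
    rfl

theorem Emb.exists_bulletR {φ ρ : ℕ → ℕ} {n : ℕ} {P : List QTok} {A : List RTok} {σ : List ℕ}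
    (h : Emb φ ρ n P A σ) (i : ℕ) {S : List RTok} (hS : 1 ≤ nbs S) :
    ∃ φ', Emb φ' ρ n P (_root_.bulletR A i S) σ := by
  induction S with
  | nil => simp at hS
  | cons t S ih =>
    cases t with
    | blk bs => exact ⟨_, ((h.loc_copyR i bs).append_right _).append_right _⟩
    | _ =>
      obtain ⟨φ', h'⟩ := ih (by simpa [RTok.nb] using hS)
      exact ⟨φ', Emb.skip _ h'⟩

theorem Emb.exists_HSR_le {φ ρ : ℕ → ℕ} {n k r m : ℕ} {P : List QTok} {σ : List ℕ}
    (h : Emb φ ρ n P (HSR k r) σ) (hrm : r ≤ m) : ∃ φ', Emb φ' ρ n P (HSR k m) σ := by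
  induction m, hrm using Nat.le_induction with
  | base => exact ⟨φ, h⟩
  | succ m _ ih =>
    obtain ⟨φ', h'⟩ := ih
    cases k with
    | zero =>
      rw [HSR]
      exact ⟨_, (h'.loc_copyR 0 [1, 2]).append_right _⟩
    | succ k =>
      rw [HSR]
      exact h'.exists_bulletR 0 (le_trans (by norm_num) (two_le_nbs_HSR _ _))

theorem Forced.bulletQ {k s s' : ℕ} {P Q : List QTok} (hP : ∀ c, Forced (k + 1) c s P)
    (hQ : Forced k 0 s' Q) (hs' : s' ≤ (slots P).length) (c : ℕ) :
    Forced (k + 1) c (s + 1) (bulletQ P 0 Q) := by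
  obtain ⟨hQlen, rQ, hQ⟩ := hQ
  obtain ⟨hPlen, rP, hP⟩ := hP (max c rQ)
  refine ⟨hPlen.bulletQ 0 Q, max rP rQ + 1, fun ρ hρ hρ0 m hm hρm => ?_⟩
  have hr : max rP rQ + 1 ≤ ρ s := hρ0.trans (hρ.monotone (Nat.zero_le s))
  have hrP := le_max_left rP rQ
  have hrQ := le_max_right rP rQ
  obtain ⟨r, hrs⟩ : ∃ r, ρ s = r + 1 := ⟨ρ s - 1, by omega⟩
  obtain ⟨φP, σ, hP, hσc⟩ := hP ρ hρ (by omega) r (by omega) fun t ht => by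
    have := hρ ht
    omega
  obtain ⟨hσlen, hσlt, hσN⟩ := hP.slots_spec
  have hN := lt_nbs_HSR k r
  have hb := blockLen_HSR k (nbs (HSR (k + 1) r) - 1)
  rw [Nat.sub_add_cancel (by omega)] at hb
  have hA := blockLen_HSR (k + 1) r
  have hstep : HSR (k + 1) (r + 1) =
      bulletR (HSR (k + 1) r) 0 (HSR k (nbs (HSR (k + 1) r) - 1)) := by rw [HSR]
  generalize HSR (k + 1) r = A at *
  set N := nbs A with hNdef
  let ρQ : ℕ → ℕ := fun t => σ.getD t (N + t)
  have hget : ∀ t (ht : t < σ.length), ρQ t = σ[t] := fun t ht => by simp [ρQ, ht]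
  have hget' : ∀ t, σ.length ≤ t → ρQ t = N + t := fun t ht => by simp [ρQ, ht]
  have hmono : StrictMono ρQ := by
    intro x y hxy
    rcases lt_or_ge y σ.length with hy | hy
    · rw [hget y hy, hget x (hxy.trans hy)]
      exact List.pairwise_iff_getElem.1 hσlt x y _ hy hxy
    · rw [hget' y hy]
      rcases lt_or_ge x σ.length with hx | hx
      · rw [hget x hx]
        have := (hσN _ (List.getElem_mem hx)).2
        omega
      · rw [hget' x hx]
        omega
  have hρQ0 : rQ ≤ ρQ 0 := by
    rcases Nat.eq_zero_or_pos σ.length with h | h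
    · rw [hget' 0 h.le]
      omega
    · rw [hget 0 h]
      exact (le_max_right _ _).trans (hσc _ (List.getElem_mem h))
  obtain ⟨φQ, τ, hQ, -⟩ := hQ ρQ hmono hρQ0 (N - 1) (by omega) fun t ht => by
    have ht' : t < σ.length := by omega
    rw [hget t ht']
    have := (hσN _ (List.getElem_mem ht')).2
    omega
  let φ' : ℕ → ℕ := fun x => if x % 2 = 1 then glob (φQ (x / 2)) else
    loc (τ.getD (Nat.unpair (x / 2)).1 0) (φP (Nat.unpair (x / 2)).2)
  have hloc : ∀ j I, τ[j]? = some I → ∀ a, φ' (loc (0 + j) a) = loc I (φP a) := by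
    intro j I hj a
    simp [φ', loc, hj]
  have hglob : ∀ d, φ' (glob d) = glob (φQ d) := by
    intro d
    have h1 : (2 * d + 1) % 2 = 1 := by omega
    have h2 : (2 * d + 1) / 2 = d := by omega
    simp only [φ', glob, h1, h2, if_true]
  have hE := hQ.bulletR hP hPlen (by rw [hrs]; exact hA) hQlen hb hmono
    (fun t ht => by
      have ht' : t < σ.length := by omega
      rw [hget t ht', List.getElem?_eq_getElem ht'])
    0 hloc hglob
  rw [zero_mul, ← hstep] at hE
  obtain ⟨φ'', hE'⟩ := hE.exists_HSR_le (m := m) (by rw [← hrs]; exact hρm s (Nat.lt_succ_self s))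
  refine ⟨φ'', _, hE', fun j hj => ?_⟩
  simp only [List.mem_flatMap, List.mem_map] at hj
  obtain ⟨I, -, x, hx, rfl⟩ := hj
  have := hσc x hx
  have := le_max_left c rQ
  omega

/-! ### Simplification of patterns -/

/-- The entries `as` are among those of `bs`, up to relabeling by `f`. -/
def entriesLe (f : ℕ → ℕ) : List (Option ℕ) → List (Option ℕ) → Bool
  | [], _ => true
  | none :: as, _ :: bs => entriesLe f as bs
  | some a :: as, b :: bs => decide (b = some (f a)) && entriesLe f as bs
  | _ :: _, [] => false

/-- The pattern token `q` is less specific than `p`, up to relabeling by `f`. -/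
def tokLe (f : ℕ → ℕ) : QTok → QTok → Bool
  | QTok.L a, QTok.L b => decide (b = f a)
  | QTok.M a, QTok.M b => decide (b = f a)
  | QTok.R a, QTok.R b => decide (b = f a)
  | QTok.L a, QTok.B bs => decide (some (f a) ∈ bs)
  | QTok.B as, QTok.B bs => entriesLe f as bs
  | _, _ => false

/-- The pattern `P'` is greedily found in the pattern `P`, up to relabeling by `f`. -/
def prunes (f : ℕ → ℕ) : List QTok → List QTok → Bool
  | [], _ => true
  | _ :: _, [] => false
  | q :: P', p :: P => if tokLe f q p then prunes f P' P else prunes f (q :: P') P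

theorem getElem?_of_entriesLe {f : ℕ → ℕ} {as' as : List (Option ℕ)}
    (h : entriesLe f as' as = true) {t a : ℕ} (hta : as'[t]? = some (some a)) :
    as[t]? = some (some (f a)) := by
  induction as' generalizing as t with
  | nil => simp at hta
  | cons x as' ih =>
    cases as with
    | nil => cases x <;> simp [entriesLe] at h
    | cons y as =>
      have hrest : entriesLe f as' as = true ∧ ∀ b, x = some b → y = some (f b) := by
        cases x <;> simp_all [entriesLe]
      cases t with
      | zero => simpa using hrest.2 a (by simpa using hta)
      | succ t => simpa using ih hrest.1 (t := t) (by simpa using hta)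

theorem Emb.prune {φ ρ f : ℕ → ℕ} {n : ℕ} {P P' : List QTok} {S : List RTok} {σ : List ℕ}
    (h : Emb φ ρ n P S σ) (hf : prunes f P' P = true) :
    ∃ σ', Emb (φ ∘ f) ρ n P' S σ' ∧ σ' ⊆ σ := by
  induction h generalizing P' with
  | nil =>
    cases P' with
    | nil => exact ⟨[], Emb.nil _ _, by simp⟩
    | cons q P' => simp [prunes] at hf
  | skip t _ ih =>
    obtain ⟨σ', h1, h2⟩ := ih hf
    exact ⟨σ', Emb.skip t h1, h2⟩
  | mid a _ ih =>
    cases P' with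
    | nil => exact ⟨[], Emb.nil _ _, by simp⟩
    | cons q P' =>
      rw [prunes] at hf
      split_ifs at hf with hq
      · obtain ⟨σ', h1, h2⟩ := ih hf
        cases q <;> simp [tokLe] at hq
        subst hq
        exact ⟨σ', Emb.mid _ h1, h2⟩
      · obtain ⟨σ', h1, h2⟩ := ih hf
        exact ⟨σ', Emb.skip _ h1, h2⟩
  | last a _ ih =>
    cases P' with
    | nil => exact ⟨[], Emb.nil _ _, by simp⟩
    | cons q P' =>
      rw [prunes] at hf
      split_ifs at hf with hq
      · obtain ⟨σ', h1, h2⟩ := ih hf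
        cases q <;> simp [tokLe] at hq
        subst hq
        exact ⟨σ', Emb.last _ h1, h2⟩
      · obtain ⟨σ', h1, h2⟩ := ih hf
        exact ⟨σ', Emb.skip _ h1, h2⟩
  | left ha _ ih =>
    cases P' with
    | nil => exact ⟨[], Emb.nil _ _, by simp⟩
    | cons q P' =>
      rw [prunes] at hf
      split_ifs at hf with hq
      · obtain ⟨σ', h1, h2⟩ := ih hf
        cases q <;> simp [tokLe] at hq
        subst hq
        exact ⟨σ', Emb.left ha h1, h2⟩
      · obtain ⟨σ', h1, h2⟩ := ih hf
        exact ⟨σ', Emb.skip _ h1, h2⟩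
  | block hs _ ih =>
    cases P' with
    | nil => exact ⟨[], Emb.nil _ _, by simp⟩
    | cons q P' =>
      rw [prunes] at hf
      split_ifs at hf with hq
      · obtain ⟨σ', h1, h2⟩ := ih hf
        cases q with
        | L b =>
          simp only [tokLe, decide_eq_true_eq] at hq
          obtain ⟨t, ht⟩ := List.mem_iff_getElem?.1 hq
          exact ⟨σ', Emb.left (List.mem_of_getElem? (hs t _ ht)) h1,
            List.subset_cons_of_subset _ h2⟩
        | B as =>
          exact ⟨_, Emb.block (fun t a hta => hs t (f a) (getElem?_of_entriesLe hq hta)) h1,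
            List.cons_subset_cons _ h2⟩
        | _ => simp [tokLe] at hq
      · obtain ⟨σ', h1, h2⟩ := ih hf
        exact ⟨σ', Emb.skip _ h1, List.subset_cons_of_subset _ h2⟩

theorem Forced.prune {k c s : ℕ} {P P' : List QTok} (hP : Forced k c s P) (f : ℕ → ℕ)
    (hlen : SlotLen s P') (hf : prunes f P' P = true) : Forced k c s P' := by
  obtain ⟨-, r₀, hP⟩ := hP
  refine ⟨hlen, r₀, fun ρ hρ h0 m hm hρm => ?_⟩
  obtain ⟨φ, σ, h, hσ⟩ := hP ρ hρ h0 m hm hρm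
  obtain ⟨σ', h', hsub⟩ := h.prune hf
  exact ⟨_, σ', h', fun j hj => hσ j (hsub hj)⟩

/-- Removal of the first entry of all special blocks of a pattern. -/
def unlabel : List QTok → List QTok
  | [] => []
  | QTok.B as :: P => QTok.B as.tail :: unlabel P
  | QTok.L a :: P => QTok.L a :: unlabel P
  | QTok.M a :: P => QTok.M a :: unlabel P
  | QTok.R a :: P => QTok.R a :: unlabel P

theorem SlotLen.unlabel {s : ℕ} {P : List QTok} (hP : SlotLen (s + 1) P) :
    SlotLen s (unlabel P) := by
  induction P with
  | nil => simp [_root_.unlabel, SlotLen, slots]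
  | cons p P ih =>
    cases p with
    | B as =>
      have hP : ∀ bs ∈ as :: slots P, bs.length = s + 1 := hP
      intro bs hbs
      rcases List.mem_cons.1 hbs with rfl | hbs
      · simp [hP as (by simp)]
      · exact ih (fun cs hcs => hP cs (by simp [hcs])) bs hbs
    | _ => exact ih hP

theorem Emb.unlabel {φ ρ ρ' : ℕ → ℕ} {n : ℕ} {P : List QTok} {S : List RTok} {σ : List ℕ}
    (h : Emb φ ρ' n P S σ) (hρ : ∀ t, ρ' (t + 1) = ρ t) : Emb φ ρ n (unlabel P) S σ := by
  induction h with
  | nil => exact Emb.nil _ _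
  | skip t _ ih => exact Emb.skip t ih
  | mid a _ ih => exact Emb.mid a ih
  | last a _ ih => exact Emb.last a ih
  | left ha _ ih => exact Emb.left ha ih
  | block hs _ ih =>
    refine Emb.block (fun t a hta => ?_) ih
    rw [← hρ]
    exact hs (t + 1) a (by simpa using hta)

theorem Forced.unlabel {k c s : ℕ} {P : List QTok} (hP : Forced k c (s + 1) P) :
    Forced k c s (unlabel P) := by
  obtain ⟨hlen, r₀, hP⟩ := hP
  refine ⟨hlen.unlabel, r₀ + 1, fun ρ hρ h0 m hm hρm => ?_⟩
  let ρ' : ℕ → ℕ := fun t => t.casesOn r₀ ρ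
  have hρ' : StrictMono ρ' := by
    refine strictMono_nat_of_lt_succ fun t => ?_
    cases t with
    | zero => exact h0
    | succ t => exact hρ (Nat.lt_succ_self t)
  obtain ⟨φ, σ, h, hσ⟩ := hP ρ' hρ' le_rfl m (by omega) fun t ht => by
    cases t with
    | zero => exact Nat.le_of_succ_le hm
    | succ t => exact hρm t (by omega)
  exact ⟨φ, σ, h.unlabel fun _ => rfl, hσ⟩

/-! ### Basic patterns -/

theorem Emb.empties {φ ρ : ℕ → ℕ} (c l n : ℕ) (S : List RTok) (h : max c n + l ≤ n + nbs S) :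
    ∃ σ, Emb φ ρ n (List.replicate l (QTok.B [])) S σ ∧ ∀ j ∈ σ, c ≤ j := by
  induction S generalizing l n with
  | nil =>
    simp only [nbs_nil] at h
    obtain rfl : l = 0 := by omega
    exact ⟨[], Emb.nil _ _, by simp⟩
  | cons t S ih =>
    rw [nbs_cons] at h
    cases l with
    | zero => exact ⟨[], Emb.nil _ _, by simp⟩
    | succ l =>
      cases t with
      | blk bs =>
        simp only [RTok.nb] at h
        by_cases hn : n < c
        · obtain ⟨σ, h1, h2⟩ := ih (l + 1) (n + 1) (by omega)
          exact ⟨σ, Emb.skip _ h1, h2⟩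
        · obtain ⟨σ, h1, h2⟩ := ih l (n + 1) (by omega)
          refine ⟨n :: σ, Emb.block (fun t a hta => by simp at hta) h1, ?_⟩
          simpa using ⟨not_lt.1 hn, h2⟩
      | _ =>
        simp only [RTok.nb] at h
        obtain ⟨σ, h1, h2⟩ := ih (l + 1) n (by omega)
        exact ⟨σ, Emb.skip _ h1, h2⟩

theorem forced_empties (k l c : ℕ) : Forced (k + 1) c 0 (List.replicate l (QTok.B [])) := by
  refine ⟨?_, c + l, fun ρ _ _ m hm _ => ?_⟩
  · induction l with
    | zero => simp [SlotLen, slots]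
    | succ l ih =>
      intro as has
      rcases List.mem_cons.1 has with rfl | has
      · rfl
      · exact ih as has
  · have := lt_nbs_HSR k m
    exact ⟨id, Emb.empties c l 0 _ (by omega)⟩

theorem Emb.first_copyR {φ ρ : ℕ → ℕ} {a c : ℕ} (i n : ℕ) {A : List RTok} (cs : List ℕ)
    (hA : BlockLen (ρ 0) A) (hn : 1 ≤ nbs A) (ha : φ a = glob c) :
    Emb φ ρ n [QTok.B [some a]] (_root_.copyR i A (c :: cs)) [n] := by
  induction A with
  | nil => simp at hn
  | cons t A ih =>
    cases t with
    | blk bs =>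
      refine Emb.block (fun t b htb => ?_) (Emb.nil _ _)
      have hlen := hA bs (by simp)
      cases t with
      | zero =>
        obtain rfl : a = b := by simpa using htb
        simp [← hlen, ha]
      | succ t => simp at htb
    | _ => exact Emb.skip _ (ih hA.tail (by simpa [RTok.nb] using hn))

/-- A single block containing some symbols, followed by their last occurrences. -/
def patOne (t : ℕ) : List QTok :=
  QTok.B ((List.range t).map some) :: (List.range t).map QTok.R

theorem forced_patOne_base : Forced 0 0 1 (patOne 1) := by
  refine ⟨by decide, 1, fun ρ _ h0 m hm hρm => ?_⟩
  obtain ⟨r, hr⟩ : ∃ r, ρ 0 = r + 1 := ⟨ρ 0 - 1, by omega⟩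
  have h1 : Emb (fun _ => glob 1) ρ 0 [QTok.B [some 0]] (copyR 0 (HSR 0 r) [1, 2]) [0] :=
    Emb.first_copyR 0 0 [2] (by rw [hr]; exact blockLen_HSR 0 r) (by simp [nbs_HSR_zero]) rfl
  have h2 : Emb (fun _ => glob 1) ρ 0 (patOne 1) (HSR 0 (r + 1)) [0] := by
    rw [HSR]
    exact h1.append (Emb.skip _ (Emb.last 0 (Emb.nil _ _)))
  obtain ⟨φ, h3⟩ := h2.exists_HSR_le (m := m) (by rw [← hr]; exact hρm 0 one_pos)
  exact ⟨φ, [0], h3, by simp⟩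

/-! ### Events of a pattern -/

/-- The events of a pattern token. -/
def QTok.evs : QTok → List Ev
  | L a => [Ev.L a]
  | M a => [Ev.M a]
  | R a => [Ev.R a]
  | B as => (as.filterMap id).map Ev.L

/-- The events of a pattern. -/
def evsQ (P : List QTok) : List Ev := P.flatMap QTok.evs

theorem Emb.evs_sublist {φ ρ : ℕ → ℕ} (hρ : StrictMono ρ) {n : ℕ} {P : List QTok}
    {S : List RTok} {σ : List ℕ} (h : Emb φ ρ n P S σ) :
    ((evsQ P).map (Ev.map φ)).Sublist (evs S) := by
  induction h with
  | nil => simp [evsQ]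
  | skip t _ ih => exact ih.trans (List.sublist_append_right _ _)
  | mid a _ ih => exact ih.cons_cons _
  | last a _ ih => exact ih.cons_cons _
  | @left n P S σ a bs ha _ ih =>
    have h1 : [Ev.L (φ a)].Sublist (RTok.blk bs).evs :=
      List.singleton_sublist.2 (List.mem_append_left _ (List.mem_map_of_mem ha))
    exact h1.append ih
  | @block n P S σ as bs hs _ ih =>
    have h1 : (((as.filterMap id).map φ).map Ev.L).Sublist (RTok.blk bs).evs :=
      ((hs.sublist hρ).map Ev.L).trans (List.sublist_append_left _ _)
    have h2 : (evsQ (QTok.B as :: P)).map (Ev.map φ) =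
        ((as.filterMap id).map φ).map Ev.L ++ (evsQ P).map (Ev.map φ) := by
      simp [evsQ, QTok.evs, List.flatMap_cons, Function.comp_def, Ev.map]
    rw [h2]
    exact h1.append ih

/-! ### The pattern used in the proof -/

/-- Two blocks within the span of a symbol lying in the first one. -/
def patTwo : List QTok := [.B [some 0], .B [none], .R 0]

/-- Two blocks, the first one with two symbols whose last occurrences precede and follow
the second block, respectively. -/
def patPair : List QTok := [.B [some 0, some 1], .R 0, .B [none, none], .R 1]

/-- Five blocks distributed over the intervals determined by two crossing symbols. -/
def patFrame : List QTok :=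
  [.L 0, .L 1, .B [none], .B [none], .B [none], .M 1, .R 0, .B [none], .B [none], .R 1]

/-- An `N`-shaped triple of symbols with two blocks in its intervals. -/
def patCore : List QTok :=
  [.L 0, .L 1, .B [some 3], .L 2, .M 1, .R 0, .B [some 4], .R 1, .R 3, .R 2, .R 4]

/-- Two blocks of length four, separated by the last occurrence of the third symbol of the
first one. -/
def patThird : List QTok :=
  [.B [none, none, some 0, none], .R 0, .B [none, none, none, none]]

/-- An `N`-shaped triple of symbols with five blocks in its intervals. -/
def patGadget : List QTok :=
  [.L 0, .L 1, .B [none, none], .B [none, none], .L 2, .M 1, .R 0, .B [none, none],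
    .B [none, none], .R 1, .R 2, .B [none, none]]

/-- The shuffle of patterns that yields the four groups of five symbols. -/
def patGroups : List QTok :=
  bulletQ (bulletQ (bulletQ (bulletQ (patOne 1) 0 patCore) 0 (patOne 2)) 0
    (bulletQ patCore 0 (patOne 2))) 0 (patOne 4)

/-- The final pattern. -/
def patFinal : List QTok := bulletQ patGadget 0 patGroups

theorem forced_patOne_one (k : ℕ) : ∀ c, Forced (k + 1) c 1 (patOne 1) := by
  induction k with
  | zero =>
    exact fun c => (Forced.bulletQ (fun c => forced_empties 0 1 c) forced_patOne_base
      (by decide) c).prune glob (by decide) (by decide)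
  | succ k ih =>
    exact fun c => (Forced.bulletQ (fun c => forced_empties (k + 1) 1 c) (ih 0)
      (by decide) c).prune glob (by decide) (by decide)

theorem forced_patOne_one_zero (k : ℕ) : Forced k 0 1 (patOne 1) := by
  cases k with
  | zero => exact forced_patOne_base
  | succ k => exact forced_patOne_one k 0

theorem forced_patOne_two (k c : ℕ) : Forced (k + 1) c 2 (patOne 2) :=
  (Forced.bulletQ (forced_patOne_one k) (forced_patOne_one_zero k) (by decide) c).prune
    (fun a => [loc 0 0, glob 0].getD a 0) (by decide) (by decide)

theorem forced_patOne_three (k c : ℕ) : Forced (k + 1) c 3 (patOne 3) :=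
  (Forced.bulletQ (forced_patOne_two k) (forced_patOne_one_zero k) (by decide) c).prune
    (fun a => [loc 0 0, loc 0 1, glob 0].getD a 0) (by decide) (by decide)

theorem forced_patOne_four (k c : ℕ) : Forced (k + 1) c 4 (patOne 4) :=
  (Forced.bulletQ (forced_patOne_three k) (forced_patOne_one_zero k) (by decide) c).prune
    (fun a => [loc 0 0, loc 0 1, loc 0 2, glob 0].getD a 0) (by decide) (by decide)

theorem forced_patTwo (k c : ℕ) : Forced (k + 1) c 1 patTwo :=
  (Forced.bulletQ (fun c => forced_empties k 2 c) (forced_patOne_one_zero k) (by decide) c).prune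
    glob (by decide) (by decide)

theorem forced_patPair (k c : ℕ) : Forced (k + 2) c 2 patPair :=
  (Forced.bulletQ (forced_patOne_one (k + 1)) (forced_patTwo k 0) (by decide) c).prune
    (fun a => [loc 0 0, glob 0].getD a 0) (by decide) (by decide)

theorem forced_patFrame (k c : ℕ) : Forced (k + 3) c 1 patFrame :=
  (Forced.bulletQ (fun c => forced_empties (k + 2) 5 c) (forced_patPair k 0) (by decide) c).prune
    (fun a => [glob 0, glob 1].getD a 0) (by decide) (by decide)

theorem forced_patCore (k c : ℕ) : Forced (k + 3) c 1 patCore := by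
  have h : ∀ c, Forced (k + 3) c 1
      [.L 0, .L 1, .B [none], .B [none], .M 1, .R 0, .B [none], .R 1] :=
    fun c => (forced_patFrame k c).prune id (by decide) (by decide)
  exact (Forced.bulletQ h (forced_patOne_three (k + 1) 0) (by decide) c).unlabel.prune
    (fun a => [loc 0 0, loc 0 1, glob 1, glob 0, glob 2].getD a 0) (by decide) (by decide)

theorem forced_patThird (k c : ℕ) : Forced (k + 2) c 4 patThird :=
  (Forced.bulletQ (forced_patOne_three (k + 1)) (forced_empties k 2 0) (by decide) c).prune
    (fun _ => loc 0 2) (by decide) (by decide)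

theorem forced_patGadget (k c : ℕ) : Forced (k + 3) c 2 patGadget :=
  (Forced.bulletQ (forced_patFrame k) (forced_patThird k 0) (by decide) c).prune
    (fun a => [loc 0 0, loc 0 1, glob 0].getD a 0) (by decide) (by decide)

theorem forced_patGroups (k c : ℕ) : Forced (k + 4) c 5 patGroups :=
  Forced.bulletQ
    (Forced.bulletQ
      (Forced.bulletQ
        (Forced.bulletQ (forced_patOne_one (k + 3)) (forced_patCore k 0) (by decide))
        (forced_patOne_two (k + 2) 0) (by decide))
      (Forced.bulletQ (forced_patCore k) (forced_patOne_two (k + 1) 0) (by decide) 0) (by decide))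
    (forced_patOne_four (k + 2) 0) (by decide) c

theorem forced_patFinal (k : ℕ) : Forced (k + 5) 0 3 patFinal :=
  Forced.bulletQ (forced_patGadget (k + 2)) (forced_patGroups k 0) (by decide) 0

/-! ### Order of the events of the final pattern

The groups of five symbols are indexed by `c s : ℕ` with `c, s < 2`. -/

/-- The `t`-th symbol of the group `(c, s)`, for `t < 5`. -/
def grp (c s : ℕ) : ℕ → ℕ
  | 0 => glob (loc 0 (loc c (loc 0 (loc s 0))))
  | 1 => glob (loc 0 (loc c (loc 0 (glob (3 + s)))))
  | 2 => glob (loc 0 (loc c (glob s)))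
  | 3 => glob (loc 0 (glob (if s = 0 then loc 0 (3 + c) else glob c)))
  | _ => glob (glob (2 * c + s))

/-- The `t`-th symbol of the `N`-shaped triple around the group `(c, s)`. -/
def gad (c s t : ℕ) : ℕ := loc (2 * c + s) t

/-- The `t`-th symbol of the `N`-shaped triple separating the groups `(c, 0)` and `(c, 1)`. -/
def inner (c t : ℕ) : ℕ := glob (loc 0 (loc c (loc 0 (glob t))))

/-- The `t`-th symbol of the `N`-shaped triple separating two groups `(0, _)` and `(1, _)`. -/
def outer (t : ℕ) : ℕ := glob (loc 0 (glob (loc 0 t)))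

/-- The triple of symbols `a`, `b`, `c` is `N`-shaped in `s`. -/
def NShaped (s : List ℕ) (a b c : ℕ) : Prop := [a, b, c, b, a, b, c].Sublist s

instance (s : List ℕ) (a b c : ℕ) : Decidable (NShaped s a b c) :=
  inferInstanceAs (Decidable ([a, b, c, b, a, b, c].Sublist s))

open Ev in
theorem gadget_order : ∀ c < 2, ∀ s < 2,
    [L (gad c s 0), L (gad c s 1), L (grp c s 0), L (grp c s 1), L (gad c s 2), R (gad c s 0),
      L (grp c s 2), L (grp c s 3), R (gad c s 1), R (gad c s 2), L (grp c s 4), R (grp c s 0),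
      R (grp c s 1), R (grp c s 2), R (grp c s 3), R (grp c s 4)].Sublist (evsQ patFinal) := by
  decide +kernel

theorem gadget_nShaped : ∀ c < 2, ∀ s < 2,
    NShaped ((evsQ patFinal).map Ev.sym) (gad c s 0) (gad c s 1) (gad c s 2) ∧
    NShaped ((evsQ patFinal).map Ev.sym) (grp c s 0) (grp c s 1) (grp c s 2) ∧
    NShaped ((evsQ patFinal).map Ev.sym) (grp c s 2) (grp c s 3) (grp c s 4) := by
  decide +kernel

open Ev in
theorem inner_order : ∀ c < 2,
    [L (inner c 0), L (inner c 1), L (grp c 0 2), R (grp c 0 0), L (inner c 2), R (inner c 0),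
      L (grp c 1 2), R (grp c 1 0), R (inner c 1), R (inner c 2),
      R (grp c 1 1)].Sublist (evsQ patFinal) ∧
    [R (inner c 0), R (grp c 0 1)].Sublist (evsQ patFinal) := by
  decide +kernel

theorem inner_nShaped : ∀ c < 2,
    NShaped ((evsQ patFinal).map Ev.sym) (inner c 0) (inner c 1) (inner c 2) := by
  decide +kernel

open Ev in
theorem outer_order : ∀ s < 2, ∀ s' < 2,
    [L (outer 0), L (outer 1), L (grp 0 s 4), R (grp 0 s 2), L (outer 2), R (outer 0),
      L (grp 1 s' 4), R (grp 1 s' 2), R (outer 1), R (outer 2),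
      R (grp 1 s' 3)].Sublist (evsQ patFinal) ∧
    [R (outer 0), R (grp 0 s 3)].Sublist (evsQ patFinal) := by
  decide +kernel

theorem outer_nShaped :
    NShaped ((evsQ patFinal).map Ev.sym) (outer 0) (outer 1) (outer 2) := by
  decide +kernel

/-! ### Concave intersections on the parabola -/

theorem mem_Seg {b B x : ℝ} (hbB : b < B) (hb : b ≤ x) (hB : x ≤ B) :
    (x, (b + B) * x - b * B) ∈ Seg b B := by
  have h : 0 < B - b := sub_pos.2 hbB
  refine ⟨(B - x) / (B - b), (x - b) / (B - b), div_nonneg (by linarith) h.le,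
    div_nonneg (by linarith) h.le, ?_, ?_⟩
  · field_simp
    ring
  · ext
    · simp only [Ppt, Prod.fst_add, Prod.smul_fst, smul_eq_mul]
      field_simp
      ring
    · simp only [Ppt, Prod.snd_add, Prod.smul_snd, smul_eq_mul]
      field_simp
      ring

theorem crossing_mem {b B c C : ℝ} (h₁ : b < c) (h₂ : c < B) (h₃ : B < C) :
    ∃ y, ((c * C - b * B) / (c + C - b - B), y) ∈ Seg c C ∩ Seg b B := by
  have hD : 0 < c + C - b - B := by linarith
  set x := (c * C - b * B) / (c + C - b - B) with hx
  have hxD : x * (c + C - b - B) = c * C - b * B := div_mul_cancel₀ _ hD.ne'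
  have hc : c ≤ x := by
    rw [hx, le_div_iff₀ hD]
    nlinarith [mul_pos (sub_pos.2 h₁) (sub_pos.2 h₂)]
  have hB : x ≤ B := by
    rw [hx, div_le_iff₀ hD]
    nlinarith [mul_pos (sub_pos.2 h₂) (sub_pos.2 h₃)]
  refine ⟨(b + B) * x - b * B, ?_, mem_Seg (h₁.trans h₂) (h₁.le.trans hc) hB⟩
  have : (b + B) * x - b * B = (c + C) * x - c * C := by linarith
  rw [this]
  exact mem_Seg (h₂.trans h₃) hc (hB.trans h₃.le)

/-- Three concavely intersecting segments satisfy two inequalities between products of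
lengths of consecutive intervals. -/
theorem ConcaveChain.mul_lt {xL xR : ℕ → ℝ} {a b c : ℕ} (h : ConcaveChain xL xR [a, b, c])
    (h₁ : xL a < xL b) (h₂ : xL b < xL c) (h₃ : xL c < xR a) (h₄ : xR a < xR b)
    (h₅ : xR b < xR c) :
    (xL c - xL b) * (xR b - xR a) < (xL b - xL a) * (xR a - xL c) ∧
      (xL c - xL b) * (xR b - xR a) < (xR a - xL c) * (xR c - xR b) := by
  obtain ⟨y, hy⟩ := crossing_mem h₂ (h₃.trans h₄) h₅
  obtain ⟨y', hy'⟩ := crossing_mem h₁ (h₂.trans h₃) h₄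
  have hlt := h 0 le_rfl _ _ hy hy'
  dsimp only at hlt
  rw [div_lt_div_iff₀ (by linarith) (by linarith)] at hlt
  have hprod : (xL c - xL b) * (xR b - xR a) * (xR c - xL a) <
      (xL b - xL a) * (xR a - xL c) * (xR c - xR b) := by nlinarith
  have hd : 0 < (xL c - xL b) * (xR b - xR a) := mul_pos (by linarith) (by linarith)
  have hT : 0 < xR c - xL a := by linarith
  constructor
  · refine lt_of_mul_lt_mul_right (hprod.trans_le ?_) hT.le
    exact mul_le_mul_of_nonneg_left (by linarith)
      (mul_nonneg (by linarith) (by linarith))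
  · refine lt_of_mul_lt_mul_right (hprod.trans_le ?_) hT.le
    rw [mul_assoc, mul_comm]
    exact mul_le_mul_of_nonneg_left (by linarith)
      (mul_nonneg (by linarith) (by linarith))

theorem gadget_dichotomy {y z X Y Z g₀ g₁ g₂ g₃ g₄ G₀ G₁ G₂ G₃ : ℝ}
    (hy : y < g₀) (h1z : g₁ < z) (hzX : z < X) (hX2 : X < g₂) (h23 : g₂ < g₃)
    (h3Y : g₃ < Y) (hYZ : Y < Z) (hZ4 : Z < g₄) (h40 : g₄ < G₀) (hG02 : G₀ < G₂)
    (hg : (z - y) * (Y - X) < (X - z) * (Z - Y))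
    (h₁ : (g₂ - g₁) * (G₁ - G₀) < (g₁ - g₀) * (G₀ - g₂))
    (h₂ : (g₄ - g₃) * (G₃ - G₂) < (g₃ - g₂) * (G₂ - g₄)) :
    G₁ - G₀ < G₀ - g₂ ∨ G₃ - G₂ < G₂ - g₄ := by
  by_contra! hcon
  obtain ⟨c₁, c₂⟩ := hcon
  have e₁ : g₂ - g₁ < g₁ - g₀ := by
    refine lt_of_mul_lt_mul_right (lt_of_le_of_lt ?_ h₁) (by linarith : 0 ≤ G₀ - g₂)
    exact mul_le_mul_of_nonneg_left c₁ (by linarith)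
  have e₂ : g₄ - g₃ < g₃ - g₂ := by
    refine lt_of_mul_lt_mul_right (lt_of_le_of_lt ?_ h₂) (by linarith : 0 ≤ G₂ - g₄)
    exact mul_le_mul_of_nonneg_left c₂ (by linarith)
  have e₃ : (X - z) * (Z - Y) ≤ (z - y) * (Y - X) :=
    mul_le_mul (by linarith) (by linarith) (by linarith) (by linarith)
  linarith

theorem separation_absurd {y z X Y Z p q r p' q' r' : ℝ} (hyp : y < p)
    (hqz : q < z) (hzX : z < X) (hXr : X < r) (hXp : X < p') (hqY : q' < Y)
    (hYZ : Y < Z) (hZr : Z < r') (hg : (z - y) * (Y - X) < (X - z) * (Z - Y))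
    (h : r - q < q - p) (h' : r' - q' < q' - p') : False := by
  have : (X - z) * (Z - Y) ≤ (z - y) * (Y - X) :=
    mul_le_mul (by linarith) (by linarith) (by linarith) (by linarith)
  linarith

/-! ### The main theorem -/

/-- No choice of endpoints realizes the final pattern with its `N`-shaped triples satisfying
the inequality of `ConcaveChain.mul_lt`. -/
theorem patFinal_absurd {xL xR : ℕ → ℝ}
    (hord : ∀ l : List Ev, l.Sublist (evsQ patFinal) →
      (l.filterMap (Ev.coord xL xR)).IsChain (· < ·))
    (hN : ∀ a b c, NShaped ((evsQ patFinal).map Ev.sym) a b c →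
      xL a < xL b → xL b < xL c → xL c < xR a → xR a < xR b → xR b < xR c →
      (xL c - xL b) * (xR b - xR a) < (xL b - xL a) * (xR a - xL c) ∧
        (xL c - xL b) * (xR b - xR a) < (xR a - xL c) * (xR c - xR b)) : False := by
  have hdich : ∀ c < 2, ∀ s < 2,
      xR (grp c s 1) - xR (grp c s 0) < xR (grp c s 0) - xL (grp c s 2) ∨
      xR (grp c s 3) - xR (grp c s 2) < xR (grp c s 2) - xL (grp c s 4) := by
    intro c hc s hs
    have ho := hord _ (gadget_order c hc s hs)
    simp only [List.filterMap_cons, List.filterMap_nil, Ev.coord, List.isChain_cons_cons,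
      List.IsChain.singleton, and_true] at ho
    obtain ⟨h₁, h₂, h₃, h₄, h₅, h₆, h₇, h₈, h₉, h₁₀, h₁₁, h₁₂, h₁₃, h₁₄, h₁₅⟩ := ho
    obtain ⟨n₁, n₂, n₃⟩ := gadget_nShaped c hc s hs
    refine gadget_dichotomy h₂ h₄ h₅ h₆ h₇ h₈ h₉ h₁₀ h₁₁ (h₁₂.trans h₁₃)
      (hN _ _ _ n₁ ?_ ?_ ?_ ?_ ?_).2 (hN _ _ _ n₂ ?_ ?_ ?_ ?_ ?_).1
      (hN _ _ _ n₃ ?_ ?_ ?_ ?_ ?_).1 <;> linarith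
  have hinner : ∀ c < 2, ∃ s < 2,
      xR (grp c s 3) - xR (grp c s 2) < xR (grp c s 2) - xL (grp c s 4) := by
    intro c hc
    obtain h | h := hdich c hc 0 (by decide)
    swap
    · exact ⟨0, by decide, h⟩
    obtain h' | h' := hdich c hc 1 (by decide)
    swap
    · exact ⟨1, by decide, h'⟩
    have ho := hord _ (inner_order c hc).1
    have hr := hord _ (inner_order c hc).2
    simp only [List.filterMap_cons, List.filterMap_nil, Ev.coord, List.isChain_cons_cons,
      List.IsChain.singleton, and_true] at ho hr
    obtain ⟨h₁, h₂, h₃, h₄, h₅, h₆, h₇, h₈, h₉, h₁₀⟩ := ho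
    refine (separation_absurd h₂ h₄ h₅ hr h₆ h₈ h₉ h₁₀
      (hN _ _ _ (inner_nShaped c hc) ?_ ?_ ?_ ?_ ?_).2 h h').elim <;> linarith
  obtain ⟨s, hs, h⟩ := hinner 0 (by decide)
  obtain ⟨s', hs', h'⟩ := hinner 1 (by decide)
  have ho := hord _ (outer_order s hs s' hs').1
  have hr := hord _ (outer_order s hs s' hs').2
  simp only [List.filterMap_cons, List.filterMap_nil, Ev.coord, List.isChain_cons_cons,
    List.IsChain.singleton, and_true] at ho hr
  obtain ⟨h₁, h₂, h₃, h₄, h₅, h₆, h₇, h₈, h₉, h₁₀⟩ := ho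
  refine separation_absurd h₂ h₄ h₅ hr h₆ h₈ h₉ h₁₀
    (hN _ _ _ outer_nShaped ?_ ?_ ?_ ?_ ?_).2 h h' <;> linarith

theorem Ev.sym_map (f : ℕ → ℕ) (e : Ev) : (e.map f).sym = f e.sym := by
  cases e <;> rfl

theorem Ev.coord_map (xL xR : ℕ → ℝ) (f : ℕ → ℕ) (e : Ev) :
    (e.map f).coord xL xR = e.coord (xL ∘ f) (xR ∘ f) := by
  cases e <;> rfl

/-- Theorem `thm_HS_forces_X`: there exists an `m ≥ 1` such that the Hart–Sharir
sequence `S₇(m)` cannot be realized as a lower inner-zone sequence of the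
parabola.  Concretely, there is no family of line segments, indexed by the symbols
of `S₇(m)`, with all endpoints on the parabola `y = x²` and pairwise distinct
endpoint x-coordinates (the segment of symbol `a` joining the parabola points with
x-coordinates `xL a < xR a`), such that both:
(i) reading the endpoints by increasing x-coordinate yields exactly the endpoint
sequence `E(S₇(m))`; and
(ii) whenever distinct symbols `s 1, …, s j` form an `N`-shaped subsequence
`s 1 ⋯ s j s (j−1) ⋯ s 1 s 2 ⋯ s j` of `S₇(m)`, the corresponding `j` segments
intersect concavely. -/
theorem thm_HS_forces_X :
    ∃ m : ℕ, 1 ≤ m ∧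
      ∀ xL xR : ℕ → ℝ,
        Realizes xL xR (Efun (HS 7 m)) →
        (∀ (j : ℕ) (s : ℕ → ℕ),
          (∀ i₁ i₂, 1 ≤ i₁ → i₁ ≤ j → 1 ≤ i₂ → i₂ ≤ j → s i₁ = s i₂ → i₁ = i₂) →
          ((List.range' 1 j).map s ++ ((List.range' 1 (j - 1)).reverse.map s) ++
              ((List.range' 2 (j - 1)).map s)).Sublist (symsOf (HS 7 m)) →
          ConcaveChain xL xR ((List.range' 1 j).map s)) →
        False := by
  obtain ⟨-, r₀, hr⟩ := forced_patFinal 0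
  have hρ : StrictMono fun t => r₀ + t := fun _ _ h => Nat.add_lt_add_left h r₀
  obtain ⟨φ, σ, hemb, -⟩ := hr _ hρ le_rfl (r₀ + 3) (by omega) fun t ht => by omega
  have hsub := hemb.evs_sublist hρ
  refine ⟨r₀ + 3 + 1, by omega, fun xL xR hreal hN => ?_⟩
  rw [HS_eq_toToks 5] at hreal hN
  rw [Realizes, coordList_Efun xL xR (wellMarked_HSR 5 _)] at hreal
  refine patFinal_absurd (xL := xL ∘ φ) (xR := xR ∘ φ) (fun l hl => ?_)
    fun a b c habc h₁ h₂ h₃ h₄ h₅ => ?_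
  · have := hreal.sublist (((hl.map (Ev.map φ)).trans hsub).filterMap (Ev.coord xL xR))
    simpa only [List.filterMap_map, Function.comp_def, Ev.coord_map] using this
  · have hsyms : ([φ a, φ b, φ c, φ b, φ a, φ b, φ c] : List ℕ).Sublist
        (symsOf (toToks (HSR 5 (r₀ + 3)))) := by
      rw [symsOf_toToks]
      refine (List.Sublist.map φ habc).trans ?_
      simpa only [List.map_map, Function.comp_def, Ev.sym_map] using hsub.map Ev.sym
    have hab : φ a ≠ φ b := fun h => by simp [h] at h₁
    have hbc : φ b ≠ φ c := fun h => by simp [h] at h₂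
    have hac : φ a ≠ φ c := fun h => by
      have := h₁.trans h₂
      simp [h] at this
    have hchain : ConcaveChain xL xR [φ a, φ b, φ c] :=
      hN 3 (fun i => if i = 1 then φ a else if i = 2 then φ b else φ c)
        (fun i₁ i₂ _ _ _ _ h => by
          obtain rfl | rfl | rfl : i₁ = 1 ∨ i₁ = 2 ∨ i₁ = 3 := by omega
          all_goals obtain rfl | rfl | rfl : i₂ = 1 ∨ i₂ = 2 ∨ i₂ = 3 := by omega
          all_goals simp [hab, hbc, hac, hab.symm, hbc.symm, hac.symm] at h ⊢) hsyms
    exact hchain.mul_lt h₁ h₂ h₃ h₄ h₅
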